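/- Fix β > 0. For μ_wn^β-almost every a ∈ ℂ^ℤ there exists a global good solution α : ℤ × ℝ → ℂ of the Ablowitz–Ladik system with α_n(0) = a_n for all n ∈ ℤ, and this good solution is unique. -/

import Mathlib

open MeasureTheory
open scoped ENNReal BigOperators
noncomputable section

/-- The japanese bracket ⟨n⟩ = (1+n²)^{1/2}. -/
def jap (n : ℤ) : ℝ := Real.sqrt (1 + (n : ℝ)^2)

/-- `α : ℤ × ℝ → ℂ` is a (global) solution of the focusing Ablowitz–Ladik system:
each t ↦ α_n(t) is differentiable and i·(d/dt)α_n = −(1+|α_n|²)(α_{n+1}+α_{n−1}) + 2α_n. -/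
def ALSolution (α : ℤ → ℝ → ℂ) : Prop :=
  ∀ (n : ℤ) (t : ℝ), ∃ d : ℂ,
    HasDerivAt (α n) d t ∧
    Complex.I * d
      = -(1 + (Complex.normSq (α n t) : ℂ)) * (α (n+1) t + α (n-1) t) + 2 * α n t

/-- A good solution of the Ablowitz–Ladik system: a global solution satisfying
(i) ∃ p > q > 1 with ∫_{−T}^{T} Σ_n ⟨n⟩^{−q} |α_n(t)|^{2p} dt < ∞ for all T > 0, and
(ii) ∃ c > 0 with sup_{|t|≤T} Σ_n e^{−c⟨n⟩} |α_n(t)|² < ∞ for all T > 0. -/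
def IsGoodALSolution (α : ℤ → ℝ → ℂ) : Prop :=
  ALSolution α ∧
  (∃ p q : ℝ, 1 < q ∧ q < p ∧ ∀ T > (0:ℝ),
    (∫⁻ t in Set.Icc (-T) T, ∑' n : ℤ,
      ENNReal.ofReal (jap n ^ (-q) * ‖α n t‖ ^ (2*p))) < ⊤) ∧
  (∃ c > (0:ℝ), ∀ T > (0:ℝ),
    (⨆ t ∈ Set.Icc (-T) T, ∑' n : ℤ,
      ENNReal.ofReal (Real.exp (-(c * jap n)) * ‖α n t‖ ^ 2)) < ⊤)

/-- The one-site measure with density z ↦ (1+2β)/(π(1+|z|²)^{2+2β}) with respect to Lebesgue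
measure on ℂ. -/
def muBeta (β : ℝ) : Measure ℂ :=
  (volume : Measure ℂ).withDensity
    (fun z => ENNReal.ofReal ((1 + 2*β)/(Real.pi * (1 + Complex.normSq z) ^ (2 + 2*β))))

/-- `μ` is the white noise measure μ_wn^β on ℂ^ℤ: the probability measure whose
finite-dimensional marginals are products of the one-site measures `muBeta β`. -/
def IsWhiteNoise (β : ℝ) (μ : Measure (ℤ → ℂ)) : Prop :=
  IsProbabilityMeasure μ ∧
  ∀ (F : Finset ℤ) (A : ℤ → Set ℂ), (∀ n, MeasurableSet (A n)) →
    μ {a : ℤ → ℂ | ∀ n ∈ F, a n ∈ A n} = ∏ n ∈ F, muBeta β (A n)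

open Set Filter Topology Metric
open scoped NNReal

section Flow

variable {E : Type*} [NormedAddCommGroup E] [NormedSpace ℝ E]

/-- `Φ` is a complete flow of the autonomous vector field `V`. -/
structure IsFlow (V : E → E) (Φ : ℝ → E → E) : Prop where
  zero : ∀ x, Φ 0 x = x
  hasDerivAt : ∀ t x, HasDerivAt (fun s => Φ s x) (V (Φ t x)) t

theorem exists_isFlow [CompleteSpace E] {V : E → E} {K M : ℝ≥0} (hV : LipschitzWith K V)
    (hM : ∀ x, ‖V x‖ ≤ M) : ∃ Φ, IsFlow V Φ := by
  have key : ∀ (x : E) (n : ℕ), ∃ γ : ℝ → E, γ 0 = x ∧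
      ∀ t ∈ Ioo (-(n + 1) : ℝ) (n + 1), HasDerivAt γ (V (γ t)) t := by
    intro x n
    have h0 : (0 : ℝ) ∈ Icc (-(n + 1) : ℝ) (n + 1) := ⟨by linarith [n.cast_nonneg (α := ℝ)],
      by positivity⟩
    have hPL : IsPicardLindelof (fun _ : ℝ => V) (⟨0, h0⟩ : Icc (-(n + 1) : ℝ) (n + 1)) x
        (M * (n + 1)) 0 M K := by
      apply IsPicardLindelof.of_time_independent (fun y _ => hM y) hV.lipschitzOnWith
      simp
    obtain ⟨γ, h1, h2⟩ := hPL.exists_eq_forall_mem_Icc_hasDerivWithinAt₀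
    exact ⟨γ, h1, fun t ht => (h2 t (Ioo_subset_Icc_self ht)).hasDerivAt (Icc_mem_nhds ht.1 ht.2)⟩
  choose γ hγ0 hγ using key
  have agree : ∀ x m n, m ≤ n → EqOn (γ x m) (γ x n) (Ioo (-(m + 1) : ℝ) (m + 1)) := by
    intro x m n hmn
    have hmn' : (m : ℝ) ≤ n := by exact_mod_cast hmn
    have h0 : (0 : ℝ) ≤ m := m.cast_nonneg
    refine ODE_solution_unique_of_mem_Ioo (v := fun _ => V) (s := fun _ => univ) (t₀ := 0)
      (fun t _ => hV.lipschitzOnWith) ⟨by linarith, by linarith⟩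
      (fun t ht => ⟨hγ x m t ht, trivial⟩) (fun t ht => ⟨hγ x n t ?_, trivial⟩) ?_
    · exact ⟨by linarith [ht.1], by linarith [ht.2]⟩
    · rw [hγ0, hγ0]
  refine ⟨fun t x => γ x ⌈|t|⌉₊ t, fun x => hγ0 _ _, fun t x => ?_⟩
  set n := ⌈|t|⌉₊ with hn
  have ht : |t| < n + 1 := lt_of_le_of_lt (Nat.le_ceil _) (by linarith)
  have ht' : t ∈ Ioo (-(n + 1) : ℝ) (n + 1) := abs_lt.mp ht
  have hev : (fun s => γ x ⌈|s|⌉₊ s) =ᶠ[𝓝 t] γ x n := by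
    filter_upwards [Ioo_mem_nhds ht'.1 ht'.2] with s hs
    have hs' : |s| < ⌈|s|⌉₊ + 1 := lt_of_le_of_lt (Nat.le_ceil _) (by linarith)
    rcases le_total ⌈|s|⌉₊ n with h | h
    · exact agree x _ _ h (abs_lt.mp hs')
    · exact (agree x _ _ h hs).symm
  exact (hγ x n t ht').congr_of_eventuallyEq hev

namespace IsFlow

variable {V : E → E} {Φ : ℝ → E → E} {K M : ℝ≥0}

theorem add (h : IsFlow V Φ) (hV : LipschitzWith K V) (s t : ℝ) (x : E) :
    Φ (s + t) x = Φ s (Φ t x) := by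
  have := ODE_solution_unique_univ (v := fun _ => V) (s := fun _ => univ) (t₀ := 0)
    (f := fun r => Φ (r + t) x) (g := fun r => Φ r (Φ t x)) (fun t => hV.lipschitzOnWith)
    (fun r => ⟨(h.hasDerivAt (r + t) x).comp_add_const r t, trivial⟩)
    (fun r => ⟨h.hasDerivAt r _, trivial⟩) (by simp [h.zero])
  exact congrFun this s

theorem neg (h : IsFlow V Φ) : IsFlow (fun x => - V x) (fun t => Φ (-t)) where
  zero x := by simp [h.zero]
  hasDerivAt t x := by
    have := (h.hasDerivAt (-t) x).scomp t (hasDerivAt_neg t)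
    simpa [Function.comp_def] using this

theorem continuous_time (h : IsFlow V Φ) (x : E) : Continuous fun t => Φ t x :=
  continuous_iff_continuousAt.mpr fun t => (h.hasDerivAt t x).continuousAt

theorem dist_le_of_nonneg (h : IsFlow V Φ) (hV : LipschitzWith K V) {t : ℝ} (ht : 0 ≤ t)
    (x y : E) : dist (Φ t x) (Φ t y) ≤ dist x y * Real.exp (K * t) := by
  have := dist_le_of_trajectories_ODE (v := fun _ => V) (f := fun r => Φ r x)
    (g := fun r => Φ r y) (a := 0) (b := t) (δ := dist x y) (fun _ => hV)
    (h.continuous_time x).continuousOn (fun s _ => (h.hasDerivAt s x).hasDerivWithinAt)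
    (h.continuous_time y).continuousOn (fun s _ => (h.hasDerivAt s y).hasDerivWithinAt)
    (by simp [h.zero]) t ⟨ht, le_rfl⟩
  simpa using this

theorem lipschitzWith (h : IsFlow V Φ) (hV : LipschitzWith K V) (t : ℝ) :
    LipschitzWith (Real.toNNReal (Real.exp (K * |t|))) (Φ t) := by
  refine LipschitzWith.of_dist_le_mul fun x y => ?_
  rw [Real.coe_toNNReal _ (Real.exp_pos _).le, mul_comm]
  rcases le_total 0 t with ht | ht
  · rw [abs_of_nonneg ht]; exact h.dist_le_of_nonneg hV ht x y
  · have := h.neg.dist_le_of_nonneg (K := K) hV.neg (neg_nonneg.mpr ht) x y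
    simpa [abs_of_nonpos ht] using this

theorem lipschitzWith_time (h : IsFlow V Φ) (hM : ∀ x, ‖V x‖ ≤ M) (x : E) :
    LipschitzWith M fun t => Φ t x :=
  lipschitzWith_of_nnnorm_deriv_le (fun t => (h.hasDerivAt t x).differentiableAt)
    fun t => by rw [(h.hasDerivAt t x).deriv]; exact hM _

theorem dist_self_le (h : IsFlow V Φ) (hM : ∀ x, ‖V x‖ ≤ M) (t : ℝ) (x : E) :
    dist (Φ t x) x ≤ M * |t| := by
  simpa [h.zero] using (h.lipschitzWith_time hM x).dist_le_mul t 0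

end IsFlow

end Flow

theorem IsFlow.comp_eq_zero_of_notMem_cthickening {E : Type*} [NormedAddCommGroup E]
    [NormedSpace ℝ E] [ProperSpace E] {V : E → E} {Φ : ℝ → E → E} {M : ℝ≥0} (h : IsFlow V Φ)
    (hM : ∀ x, ‖V x‖ ≤ M) {F : E → ℝ} {t T : ℝ} (ht : |t| ≤ T) {x : E}
    (hx : x ∉ cthickening (M * T) (tsupport F)) : F (Φ t x) = 0 := by
  by_contra h0
  apply hx
  refine mem_cthickening_of_dist_le x (Φ t x) _ _ (subset_tsupport _ h0) ?_
  rw [dist_comm]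
  exact (h.dist_self_le hM t x).trans (by gcongr)

section Liouville

variable {E : Type*} [NormedAddCommGroup E] [NormedSpace ℝ E] [FiniteDimensional ℝ E]
  [MeasurableSpace E] [BorelSpace E] {μ : Measure E} [μ.IsAddHaarMeasure]
  {V : E → E} {Φ : ℝ → E → E} {K M : ℝ≥0} {J : Type*} [Fintype J] {g : J → E → ℝ} {v : J → E}

theorem integral_fderiv_eq_zero_of_divergence_free
    (hVg : ∀ x, V x = ∑ j, g j x • v j) {D : J → ℝ≥0} (hg : ∀ j, LipschitzWith (D j) (g j))
    (hgc : ∀ j, HasCompactSupport (g j)) (hdiv : ∀ x, ∑ j, lineDeriv ℝ (g j) x (v j) = 0)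
    {F : E → ℝ} {L : ℝ≥0} (hF : LipschitzWith L F) (hFc : HasCompactSupport F) :
    ∫ x, fderiv ℝ F x (V x) ∂μ = 0 := by
  have h1 : ∀ᵐ x ∂μ, fderiv ℝ F x (V x) = ∑ j, lineDeriv ℝ F x (v j) * g j x := by
    filter_upwards [hF.ae_differentiableAt (μ := μ)] with x hx
    simp [hVg x, hx.lineDeriv_eq_fderiv, mul_comm]
  have hFi : Integrable F μ := hF.continuous.integrable_of_hasCompactSupport hFc
  have hgi : ∀ j, Integrable (g j) μ :=
    fun j => (hg j).continuous.integrable_of_hasCompactSupport (hgc j)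
  have hi1 : ∀ j, Integrable (fun x => lineDeriv ℝ F x (v j) * g j x) μ := fun j =>
    (hgi j).bdd_mul (c := L * ‖v j‖) (aestronglyMeasurable_lineDeriv hF.continuous μ)
      (ae_of_all _ fun x => norm_lineDeriv_le_of_lipschitz ℝ hF)
  have hi2 : ∀ j, Integrable (fun x => lineDeriv ℝ (g j) x (-v j) * F x) μ := fun j =>
    hFi.bdd_mul (c := D j * ‖-v j‖) (aestronglyMeasurable_lineDeriv (hg j).continuous μ)
      (ae_of_all _ fun x => norm_lineDeriv_le_of_lipschitz ℝ (hg j))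
  rw [integral_congr_ae h1, integral_finsetSum _ fun j _ => hi1 j]
  simp_rw [fun j => LipschitzWith.integral_lineDeriv_mul_eq (μ := μ) hF (hg j) (hgc j) (v j)]
  rw [← integral_finsetSum _ fun j _ => hi2 j]
  simp [lineDeriv_neg, ← Finset.sum_mul, hdiv]

theorem hasDerivAt_integral_comp_flow_zero (h : IsFlow V Φ) (hV : LipschitzWith K V)
    (hM : ∀ x, ‖V x‖ ≤ M)
    (hVg : ∀ x, V x = ∑ j, g j x • v j) {D : J → ℝ≥0} (hg : ∀ j, LipschitzWith (D j) (g j))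
    (hgc : ∀ j, HasCompactSupport (g j)) (hdiv : ∀ x, ∑ j, lineDeriv ℝ (g j) x (v j) = 0)
    {F : E → ℝ} {L : ℝ≥0} (hF : LipschitzWith L F) (hFc : HasCompactSupport F) :
    HasDerivAt (fun t => ∫ x, F (Φ t x) ∂μ) 0 0 := by
  have : ProperSpace E := FiniteDimensional.proper ℝ E
  have hcont : ∀ t, Continuous fun x => F (Φ t x) :=
    fun t => hF.continuous.comp (h.lipschitzWith hV t).continuous
  set C := cthickening (M * 1) (tsupport F) with hC
  have hCc : IsCompact C := IsCompact.cthickening hFc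
  have := hasDerivAt_integral_of_dominated_loc_of_lip (μ := μ) (F := fun t x => F (Φ t x))
    (F' := fun x => fderiv ℝ F x (V x)) (x₀ := (0 : ℝ)) (s := ball 0 1)
    (bound := C.indicator fun _ => ((L * M : ℝ≥0) : ℝ)) (ball_mem_nhds _ one_pos)
    (Eventually.of_forall fun t => (hcont t).aestronglyMeasurable)
    (by simpa [h.zero] using hF.continuous.integrable_of_hasCompactSupport hFc)
    ?_ ?_ ?_ ?_
  · rw [integral_fderiv_eq_zero_of_divergence_free hVg hg hgc hdiv hF hFc] at this
    exact this.2
  · have hm : Measurable fun x => fderiv ℝ F x (V x) := by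
      have := measurable_fderiv ℝ F
      exact (ContinuousLinearMap.measurable_apply₂).comp (this.prodMk hV.continuous.measurable)
    exact hm.aestronglyMeasurable
  · refine ae_of_all _ fun x => ?_
    by_cases hx : x ∈ C
    · rw [indicator_of_mem hx]
      simpa [Function.comp_def] using
        (hF.comp (h.lipschitzWith_time hM x)).lipschitzOnWith (s := ball 0 1)
    · rw [indicator_of_notMem hx]
      intro s hs t ht
      have h1 := h.comp_eq_zero_of_notMem_cthickening hM (T := 1) (t := s)
        (by simpa using (mem_ball_zero_iff.mp hs).le) hx
      have h2 := h.comp_eq_zero_of_notMem_cthickening hM (T := 1) (t := t)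
        (by simpa using (mem_ball_zero_iff.mp ht).le) hx
      simp [h1, h2]
  · rw [integrable_indicator_iff hCc.measurableSet]
    exact integrableOn_const hCc.measure_lt_top.ne
  · filter_upwards [hF.ae_differentiableAt (μ := μ)] with x hx
    have h1 := h.hasDerivAt 0 x
    rw [h.zero] at h1
    have h2 : HasFDerivAt F (fderiv ℝ F x) (Φ 0 x) := by rw [h.zero]; exact hx.hasFDerivAt
    exact h2.comp_hasDerivAt 0 h1

theorem integral_comp_flow_eq (h : IsFlow V Φ) (hV : LipschitzWith K V)
    (hM : ∀ x, ‖V x‖ ≤ M)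
    (hVg : ∀ x, V x = ∑ j, g j x • v j) {D : J → ℝ≥0} (hg : ∀ j, LipschitzWith (D j) (g j))
    (hgc : ∀ j, HasCompactSupport (g j)) (hdiv : ∀ x, ∑ j, lineDeriv ℝ (g j) x (v j) = 0)
    {F : E → ℝ} {L : ℝ≥0} (hF : LipschitzWith L F) (hFc : HasCompactSupport F) (t : ℝ) :
    ∫ x, F (Φ t x) ∂μ = ∫ x, F x ∂μ := by
  have : ProperSpace E := FiniteDimensional.proper ℝ E
  have hd : ∀ t, HasDerivAt (fun t => ∫ x, F (Φ t x) ∂μ) 0 t := by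
    intro t
    have hc : HasCompactSupport fun x => F (Φ t x) :=
      HasCompactSupport.intro (IsCompact.cthickening hFc (r := M * |t|))
        fun x hx => h.comp_eq_zero_of_notMem_cthickening hM le_rfl hx
    have h0 := hasDerivAt_integral_comp_flow_zero (μ := μ) h hV hM hVg hg hgc hdiv
      (hF.comp (h.lipschitzWith hV t)) hc
    have h1 : HasDerivAt (fun s => s - t) 1 t := (hasDerivAt_id t).sub_const t
    have h2 := HasDerivAt.comp_sub_const (f := fun s => ∫ x, F (Φ t (Φ s x)) ∂μ) t t
      (by simpa using h0)
    simpa [← h.add hV] using h2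
  have := is_const_of_deriv_eq_zero (fun t => (hd t).differentiableAt) (fun t => (hd t).deriv) t 0
  simpa [h.zero] using this

theorem map_flow_le (h : IsFlow V Φ) (hV : LipschitzWith K V)
    (hM : ∀ x, ‖V x‖ ≤ M)
    (hVg : ∀ x, V x = ∑ j, g j x • v j) {D : J → ℝ≥0} (hg : ∀ j, LipschitzWith (D j) (g j))
    (hgc : ∀ j, HasCompactSupport (g j)) (hdiv : ∀ x, ∑ j, lineDeriv ℝ (g j) x (v j) = 0)
    (t : ℝ) : μ.map (Φ t) ≤ μ := by
  have : ProperSpace E := FiniteDimensional.proper ℝ E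
  have hcont : Continuous (Φ t) := (h.lipschitzWith hV t).continuous
  have hK : ∀ C : Set E, IsCompact C → μ (Φ t ⁻¹' C) ≤ μ C := by
    intro C hC
    have hlim := tendsto_measure_cthickening_of_isCompact (μ := μ) hC
    refine ge_of_tendsto (hlim.mono_left (nhdsWithin_le_nhds (s := Ioi (0 : ℝ)))) ?_
    filter_upwards [self_mem_nhdsWithin] with δ hδ
    have hδ' : (0 : ℝ) < δ := hδ
    set F : E → ℝ≥0 := fun x => thickenedIndicator hδ' C x with hFdef
    have hFl : LipschitzWith _ F := lipschitzWith_thickenedIndicator hδ' C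
    have hF : LipschitzWith (1 * _) (fun x => (F x : ℝ)) :=
      LipschitzWith.comp (g := F) (f := ((↑) : ℝ≥0 → ℝ))
        (LipschitzWith.of_dist_le_mul fun x y => by simp [NNReal.dist_eq, Real.dist_eq]) hFl
    have hF0 : ∀ x, x ∉ cthickening δ C → F x = 0 := fun x hx =>
      thickenedIndicator_zero hδ' C fun hx' => hx (thickening_subset_cthickening _ _ hx')
    have hFc : HasCompactSupport fun x => (F x : ℝ) :=
      HasCompactSupport.intro (IsCompact.cthickening hC (r := δ)) fun x hx => by simp [hF0 x hx]
    have key := integral_comp_flow_eq (μ := μ) h hV hM hVg hg hgc hdiv hF hFc t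
    have hi1 : Integrable (fun x => (F x : ℝ)) μ :=
      hF.continuous.integrable_of_hasCompactSupport hFc
    have hi2 : Integrable (fun x => (F (Φ t x) : ℝ)) μ :=
      (hF.continuous.comp hcont).integrable_of_hasCompactSupport
        (HasCompactSupport.intro (IsCompact.cthickening hFc (r := M * |t|))
        fun x hx => h.comp_eq_zero_of_notMem_cthickening hM le_rfl hx)
    have key' : ∫⁻ x, F (Φ t x) ∂μ = ∫⁻ x, F x ∂μ := by
      have e1 := ofReal_integral_eq_lintegral_ofReal hi1 (ae_of_all _ fun x => (F x).2)
      have e2 := ofReal_integral_eq_lintegral_ofReal hi2 (ae_of_all _ fun x => (F (Φ t x)).2)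
      rw [key, e1] at e2
      simpa using e2.symm
    calc μ (Φ t ⁻¹' C) = ∫⁻ x, (Φ t ⁻¹' C).indicator 1 x ∂μ := by
          rw [lintegral_indicator_one (hC.measurableSet.preimage hcont.measurable)]
      _ ≤ ∫⁻ x, F (Φ t x) ∂μ := by
          refine lintegral_mono fun x => ?_
          by_cases hx : x ∈ Φ t ⁻¹' C
          · have h1 : F (Φ t x) = 1 := thickenedIndicator_one hδ' C hx
            simp [indicator_of_mem hx, h1]
          · simp [indicator_of_notMem hx]
      _ = ∫⁻ x, F x ∂μ := key'
      _ ≤ ∫⁻ x, (cthickening δ C).indicator 1 x ∂μ := by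
          refine lintegral_mono fun x => ?_
          by_cases hx : x ∈ cthickening δ C
          · have h1 : F x ≤ 1 := thickenedIndicator_le_one hδ' C x
            simpa [indicator_of_mem hx] using h1
          · simp [hF0 x hx]
      _ = μ (cthickening δ C) := lintegral_indicator_one isClosed_cthickening.measurableSet
  refine Measure.le_iff.mpr fun s hs => ?_
  rw [Measure.map_apply hcont.measurable hs,
    (hs.preimage hcont.measurable).measure_eq_iSup_isCompact]
  refine iSup₂_le fun C hCs => iSup_le fun hC => ?_
  calc μ C ≤ μ (Φ t ⁻¹' (Φ t '' C)) := measure_mono (subset_preimage_image _ _)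
    _ ≤ μ (Φ t '' C) := hK _ (hC.image hcont)
    _ ≤ μ s := measure_mono (image_subset_iff.mpr hCs)

end Liouville

theorem IsFlow.continuous_uncurry {E : Type*} [NormedAddCommGroup E]
    [NormedSpace ℝ E] {V : E → E} {Φ : ℝ → E → E} {K M : ℝ≥0} (h : IsFlow V Φ)
    (hV : LipschitzWith K V) (hM : ∀ x, ‖V x‖ ≤ M) :
    Continuous fun p : ℝ × E => Φ p.1 p.2 :=
  continuous_prod_of_continuous_lipschitzWith (fun p : ℝ × E => Φ p.1 p.2) M
    (fun t => (h.lipschitzWith hV t).continuous) (fun x => h.lipschitzWith_time hM x)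

section FiniteSystem

variable {ι : Type*} [Fintype ι]

/-- The Ablowitz–Ladik vector field on a finite set of sites with hopping matrix `A`. -/
def alField (A : ι → ι → ℝ) (x : ι → ℂ) (n : ι) : ℂ :=
  Complex.I * (1 + (Complex.normSq (x n) : ℂ)) * (∑ m, (A n m : ℂ) * x m) - 2 * Complex.I * x n

/-- The conserved mass of the Ablowitz–Ladik system. -/
def logMass (x : ι → ℂ) : ℝ := ∑ n, Real.log (1 + Complex.normSq (x n))

/-- A smooth cutoff to the region `logMass x ≤ R + 1`. -/
def massCutoff (R : ℝ) (x : ι → ℂ) : ℝ := Real.smoothTransition (R + 1 - logMass x)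

theorem contDiff_normSq : ContDiff ℝ 1 Complex.normSq := by
  have : (Complex.normSq : ℂ → ℝ) = fun z => ‖z‖ ^ 2 := by
    ext z; rw [Complex.normSq_eq_norm_sq]
  rw [this]
  exact contDiff_norm_sq ℝ

theorem contDiff_logMass : ContDiff ℝ 1 (logMass (ι := ι)) := by
  refine ContDiff.sum fun n _ => ContDiff.log ?_ fun x => ?_
  · exact contDiff_const.add (contDiff_normSq.comp (contDiff_apply ℝ ℂ n))
  · have := Complex.normSq_nonneg (x n)
    positivity

theorem contDiff_alField (A : ι → ι → ℝ) : ContDiff ℝ 1 (alField A) := by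
  refine contDiff_pi.mpr fun n => ?_
  have h1 : ∀ n : ι, ContDiff ℝ 1 fun x : ι → ℂ => x n := fun n => contDiff_apply ℝ ℂ n
  have h2 : ContDiff ℝ 1 fun x : ι → ℂ => (Complex.normSq (x n) : ℂ) :=
    Complex.ofRealCLM.contDiff.comp (contDiff_normSq.comp (h1 n))
  have h3 : ContDiff ℝ 1 fun x : ι → ℂ => ∑ m, (A n m : ℂ) * x m :=
    ContDiff.sum fun m _ => contDiff_const.mul (h1 m)
  exact ((contDiff_const.mul (contDiff_const.add h2)).mul h3).sub (contDiff_const.mul (h1 n))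

theorem contDiff_massCutoff (R : ℝ) : ContDiff ℝ 1 (massCutoff (ι := ι) R) :=
  Real.smoothTransition.contDiff.comp (contDiff_const.sub contDiff_logMass)

theorem log_one_add_normSq_le_logMass (x : ι → ℂ) (n : ι) :
    Real.log (1 + Complex.normSq (x n)) ≤ logMass x :=
  Finset.single_le_sum (f := fun n => Real.log (1 + Complex.normSq (x n)))
    (fun m _ => Real.log_nonneg (by linarith [Complex.normSq_nonneg (x m)])) (Finset.mem_univ n)

theorem norm_le_exp_logMass (x : ι → ℂ) : ‖x‖ ≤ Real.exp (logMass x) := by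
  refine (pi_norm_le_iff_of_nonneg (Real.exp_pos _).le).mpr fun n => ?_
  have h1 := log_one_add_normSq_le_logMass x n
  have h0 := Complex.normSq_nonneg (x n)
  rw [Real.log_le_iff_le_exp (by linarith), Complex.normSq_eq_norm_sq] at h1
  nlinarith [sq_nonneg (‖x n‖ - 1)]

theorem massCutoff_eq_zero {R : ℝ} {x : ι → ℂ} (hx : x ∉ closedBall 0 (Real.exp (R + 1))) :
    massCutoff R x = 0 := by
  apply Real.smoothTransition.zero_of_nonpos
  by_contra! h
  apply hx
  rw [mem_closedBall_zero_iff]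
  exact (norm_le_exp_logMass x).trans (Real.exp_le_exp.mpr (by linarith))

theorem massCutoff_eq_one {R : ℝ} {x : ι → ℂ} (hx : logMass x ≤ R) : massCutoff R x = 1 :=
  Real.smoothTransition.one_of_one_le (by linarith)

theorem sum_flux_eq_zero {A : ι → ι → ℝ} (hA : ∀ n m, A n m = A m n) (x : ι → ℂ) :
    ∑ n, ((x n).im * (∑ m, (A n m : ℂ) * x m).re - (x n).re * (∑ m, (A n m : ℂ) * x m).im) = 0 := by
  have h : ∀ n, (x n).im * (∑ m, (A n m : ℂ) * x m).re - (x n).re * (∑ m, (A n m : ℂ) * x m).im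
      = ∑ m, A n m * ((x n).im * (x m).re - (x n).re * (x m).im) := by
    intro n
    simp only [Complex.re_sum, Complex.im_sum, Complex.re_ofReal_mul, Complex.im_ofReal_mul,
      Finset.mul_sum, ← Finset.sum_sub_distrib]
    exact Finset.sum_congr rfl fun m _ => by ring
  simp_rw [h]
  set S := ∑ n, ∑ m, A n m * ((x n).im * (x m).re - (x n).re * (x m).im) with hS
  have h2 : S = -S := by
    conv_lhs => rw [hS, Finset.sum_comm]
    rw [hS, ← Finset.sum_neg_distrib]
    refine Finset.sum_congr rfl fun n _ => ?_
    rw [← Finset.sum_neg_distrib]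
    exact Finset.sum_congr rfl fun m _ => by rw [hA m n]; ring
  linarith

theorem HasDerivAt.normSq {γ : ℝ → ℂ} {d : ℂ} {t : ℝ} (h : HasDerivAt γ d t) :
    HasDerivAt (fun s => Complex.normSq (γ s)) (2 * ((γ t).re * d.re + (γ t).im * d.im)) t := by
  have hre : HasDerivAt (fun s => (γ s).re) d.re t :=
    Complex.reCLM.hasFDerivAt.comp_hasDerivAt t h
  have him : HasDerivAt (fun s => (γ s).im) d.im t :=
    Complex.imCLM.hasFDerivAt.comp_hasDerivAt t h
  have := (hre.mul hre).add (him.mul him)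
  refine (this.congr_deriv (by ring)).congr_of_eventuallyEq (Eventually.of_forall fun s => ?_)
  simp [Complex.normSq_apply]

theorem HasDerivAt.logMass {γ : ℝ → ι → ℂ} {d : ι → ℂ} {t : ℝ} (h : HasDerivAt γ d t) :
    HasDerivAt (fun s => logMass (γ s))
      (∑ n, 2 * ((γ t n).re * (d n).re + (γ t n).im * (d n).im) /
        (1 + Complex.normSq (γ t n))) t := by
  refine HasDerivAt.fun_sum fun n _ => ?_
  refine HasDerivAt.log ((hasDerivAt_pi.mp h n).normSq.const_add 1) ?_
  linarith [Complex.normSq_nonneg (γ t n)]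

theorem HasDerivAt.alField (A : ι → ι → ℝ) {γ : ℝ → ι → ℂ} {d : ι → ℂ} {t : ℝ}
    (h : HasDerivAt γ d t) (n : ι) :
    HasDerivAt (fun s => alField A (γ s) n)
      (Complex.I * ((2 * ((γ t n).re * (d n).re + (γ t n).im * (d n).im) : ℝ) : ℂ)
          * (∑ m, (A n m : ℂ) * γ t m)
        + Complex.I * (1 + (Complex.normSq (γ t n) : ℂ)) * (∑ m, (A n m : ℂ) * d m)
        - 2 * Complex.I * d n) t := by
  have h1 := ((hasDerivAt_pi.mp h n).normSq.ofReal_comp.const_add 1).const_mul Complex.I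
  have h2 : HasDerivAt (fun s => ∑ m, (A n m : ℂ) * γ s m) (∑ m, (A n m : ℂ) * d m) t :=
    HasDerivAt.fun_sum fun m _ => (hasDerivAt_pi.mp h m).const_mul _
  exact (h1.mul h2).sub ((hasDerivAt_pi.mp h n).const_mul (2 * Complex.I))

theorem sum_alField_dot {A : ι → ι → ℝ} (hA : ∀ n m, A n m = A m n) (x : ι → ℂ) :
    ∑ n, ((x n).re * (alField A x n).re + (x n).im * (alField A x n).im)
      / (1 + Complex.normSq (x n)) = 0 := by
  rw [← sum_flux_eq_zero hA x]
  refine Finset.sum_congr rfl fun n _ => ?_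
  have h0 : (1 + Complex.normSq (x n)) ≠ 0 := by linarith [Complex.normSq_nonneg (x n)]
  rw [div_eq_iff h0]
  simp [alField, -Complex.re_sum, -Complex.im_sum]
  ring

/-- The cut-off Ablowitz–Ladik vector field. -/
def cutField (A : ι → ι → ℝ) (R : ℝ) (x : ι → ℂ) : ι → ℂ := massCutoff R x • alField A x

theorem contDiff_cutField (A : ι → ι → ℝ) (R : ℝ) : ContDiff ℝ 1 (cutField A R) :=
  (contDiff_massCutoff R).smul (contDiff_alField A)

theorem hasCompactSupport_cutField (A : ι → ι → ℝ) (R : ℝ) : HasCompactSupport (cutField A R) :=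
  HasCompactSupport.intro (isCompact_closedBall 0 (Real.exp (R + 1))) fun x hx => by
    simp [cutField, massCutoff_eq_zero hx]

/-- The coordinate `1` or `I` of a complex number. -/
def coordVec (b : Bool) : ℂ := if b then 1 else Complex.I

theorem cutField_divergence [DecidableEq ι] {A : ι → ι → ℝ} (hA : ∀ n m, A n m = A m n)
    (hA0 : ∀ n, A n n = 0) (R : ℝ) (x : ι → ℂ) :
    ∑ j : ι × Bool,
      lineDeriv ℝ (fun y => ((starRingEnd ℂ) (coordVec j.2) * cutField A R y j.1).re) x
      (Pi.single j.1 (coordVec j.2)) = 0 := by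
  obtain ⟨κ, hκ⟩ : ∃ κ, HasDerivAt Real.smoothTransition κ (R + 1 - logMass x) :=
    ⟨_, ((Real.smoothTransition.contDiff (n := 1)).differentiable (by simp)
      |>.differentiableAt).hasDerivAt⟩
  set S : ι → ℂ := fun n => ∑ m, (A n m : ℂ) * x m with hS
  have key : ∀ (n : ι) (e : ℂ),
      lineDeriv ℝ (fun y => ((starRingEnd ℂ) e * cutField A R y n).re) x (Pi.single n e) =
      ((starRingEnd ℂ) e * ((κ * (-(2 * ((x n).re * e.re + (x n).im * e.im)
        / (1 + Complex.normSq (x n)))) : ℝ) * alField A x n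
        + (massCutoff R x : ℝ) * (Complex.I * ((2 * ((x n).re * e.re + (x n).im * e.im) : ℝ) : ℂ)
          * S n - 2 * Complex.I * e))).re := by
    intro n e
    have hγ : HasDerivAt (fun s : ℝ => x + s • (Pi.single n e : ι → ℂ)) (Pi.single n e) 0 := by
      simpa using ((hasDerivAt_id (0 : ℝ)).smul_const (Pi.single n e : ι → ℂ)).const_add x
    have hm := hγ.logMass
    have hf := hγ.alField A n
    simp only [zero_smul, add_zero] at hm hf
    have e1 : ∑ m, 2 * ((x m).re * ((Pi.single n e : ι → ℂ) m).re
        + (x m).im * ((Pi.single n e : ι → ℂ) m).im) / (1 + Complex.normSq (x m))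
        = 2 * ((x n).re * e.re + (x n).im * e.im) / (1 + Complex.normSq (x n)) := by
      rw [Finset.sum_eq_single n]
      · simp
      · intro m _ hmn; simp [Pi.single_eq_of_ne hmn]
      · simp
    have e2 : ∑ m, (A n m : ℂ) * (Pi.single n e : ι → ℂ) m = 0 := by
      rw [Finset.sum_eq_single n]
      · simp [hA0]
      · intro m _ hmn; simp [Pi.single_eq_of_ne hmn]
      · simp
    rw [e1] at hm
    rw [e2] at hf
    have hc : HasDerivAt (fun s : ℝ => massCutoff R (x + s • (Pi.single n e : ι → ℂ)))
        (κ * (-(2 * ((x n).re * e.re + (x n).im * e.im) / (1 + Complex.normSq (x n))))) 0 :=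
      HasDerivAt.comp (h₂ := Real.smoothTransition) 0 (by simpa using hκ) (hm.const_sub (R + 1))
    have hV := (hc.smul hf).const_mul ((starRingEnd ℂ) e)
    have hVre := Complex.reCLM.hasFDerivAt.comp_hasDerivAt 0 hV
    have : HasLineDerivAt ℝ (fun y => ((starRingEnd ℂ) e * cutField A R y n).re) _ x
      (Pi.single n e) := hVre
    rw [this.lineDeriv]
    simp [hS]
    ring
  rw [Fintype.sum_prod_type]
  simp only [Fintype.sum_bool]
  have : ∀ n, _ := fun n => (congrArg₂ (· + ·) (key n (coordVec true)) (key n (coordVec false)))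
  rw [Finset.sum_congr rfl fun n _ => this n]
  have h3 := sum_flux_eq_zero hA x
  rw [← mul_zero (2 * (massCutoff R x - κ)), ← h3, Finset.mul_sum]
  refine Finset.sum_congr rfl fun n _ => ?_
  have h0 : (1 + Complex.normSq (x n)) ≠ 0 := by linarith [Complex.normSq_nonneg (x n)]
  have hX : (x n).re * (alField A x n).re + (x n).im * (alField A x n).im
      = ((x n).im * (S n).re - (x n).re * (S n).im) * (1 + Complex.normSq (x n)) := by
    simp [alField, -Complex.re_sum, -Complex.im_sum, hS]
    ring
  have hX' : (x n).re / (1 + Complex.normSq (x n)) * (alField A x n).re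
      + (x n).im / (1 + Complex.normSq (x n)) * (alField A x n).im
      = (x n).im * (S n).re - (x n).re * (S n).im := by
    field_simp
    linarith
  change _ = 2 * (massCutoff R x - κ) * ((x n).im * (S n).re - (x n).re * (S n).im)
  clear_value S
  clear hX
  generalize alField A x n = X at *
  have hre : ∀ (e Y Z : ℂ) (r c : ℝ), ((starRingEnd ℂ) e * ((r : ℂ) * Y + (c : ℂ) * Z)).re
      = r * (e.re * Y.re + e.im * Y.im) + c * (e.re * Z.re + e.im * Z.im) := by
    intro e Y Z r c
    simp
    ring
  rw [hre, hre]
  simp [coordVec]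
  linear_combination (-2 * κ) * hX'

theorem exists_cutFlow {A : ι → ι → ℝ} (hA : ∀ n m, A n m = A m n)
    (hA0 : ∀ n, A n n = 0) (R : ℝ) : ∃ Φ : ℝ → (ι → ℂ) → ι → ℂ,
      (∀ x, Φ 0 x = x) ∧
      (∀ t x, logMass x ≤ R → ∀ n, HasDerivAt (fun s => Φ s x n) (alField A (Φ t x) n) t) ∧
      (∀ t x, logMass (Φ t x) = logMass x) ∧
      (∀ t, (volume : Measure (ι → ℂ)).map (Φ t) ≤ volume) ∧
      Continuous fun p : ℝ × (ι → ℂ) => Φ p.1 p.2 := by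
  classical
  have hcd := contDiff_cutField A R
  have hcs := hasCompactSupport_cutField A R
  obtain ⟨K, hK⟩ := hcd.lipschitzWith_of_hasCompactSupport hcs one_ne_zero
  obtain ⟨M, hM⟩ := hcs.exists_bound_of_continuous hcd.continuous
  have hM' : ∀ x, ‖cutField A R x‖ ≤ M.toNNReal := fun x => (hM x).trans (Real.le_coe_toNNReal M)
  obtain ⟨Φ, hΦ⟩ := exists_isFlow hK hM'
  have hmass : ∀ t x, logMass (Φ t x) = logMass x := by
    intro t x
    have hd : ∀ t, HasDerivAt (fun s => logMass (Φ s x)) 0 t := by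
      intro t
      refine (hΦ.hasDerivAt t x).logMass.congr_deriv ?_
      rw [← mul_zero (2 * massCutoff R (Φ t x)), ← sum_alField_dot hA (Φ t x), Finset.mul_sum]
      refine Finset.sum_congr rfl fun n _ => ?_
      simp [cutField]
      ring
    have := is_const_of_deriv_eq_zero (fun t => (hd t).differentiableAt) (fun t => (hd t).deriv) t 0
    simpa [hΦ.zero] using this
  refine ⟨Φ, hΦ.zero, fun t x hx n => ?_, hmass, fun t => ?_, hΦ.continuous_uncurry hK hM'⟩
  · have := hasDerivAt_pi.mp (hΦ.hasDerivAt t x) n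
    rwa [cutField, massCutoff_eq_one (by rw [hmass]; exact hx), one_smul] at this
  · have hg : ∀ j : ι × Bool, ContDiff ℝ 1
        (fun y => ((starRingEnd ℂ) (coordVec j.2) * cutField A R y j.1).re) := fun j =>
      Complex.reCLM.contDiff.comp (contDiff_const.mul (contDiff_pi.mp hcd j.1))
    have hgc : ∀ j : ι × Bool, HasCompactSupport
        (fun y => ((starRingEnd ℂ) (coordVec j.2) * cutField A R y j.1).re) := fun j =>
      HasCompactSupport.intro (K := tsupport (cutField A R)) hcs.isCompact fun x hx => by
        rw [image_eq_zero_of_notMem_tsupport hx, Pi.zero_apply, mul_zero, Complex.zero_re]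
    choose D hD using fun j => (hg j).lipschitzWith_of_hasCompactSupport (hgc j) one_ne_zero
    have hsum : ∀ x, cutField A R x = ∑ j : ι × Bool,
        ((starRingEnd ℂ) (coordVec j.2) * cutField A R x j.1).re •
          (Pi.single j.1 (coordVec j.2) : ι → ℂ) := ?_
    · exact map_flow_le (μ := (volume : Measure (ι → ℂ)))
        (g := fun (j : ι × Bool) y => ((starRingEnd ℂ) (coordVec j.2) * cutField A R y j.1).re)
        (v := fun j : ι × Bool => Pi.single j.1 (coordVec j.2)) hΦ hK hM' hsum hD hgc
        (cutField_divergence hA hA0 R) t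
    intro x
    ext n
    rw [Fintype.sum_prod_type, Finset.sum_apply, Finset.sum_eq_single n]
    · apply Complex.ext <;> simp [coordVec]
    · intro m _ hmn
      simp [Pi.single_eq_of_ne (Ne.symm hmn)]
    · simp

end FiniteSystem

theorem pi_withDensity_ofReal {ι : Type*} [Fintype ι] {f : ℂ → ℝ}
    (hf0 : ∀ z, 0 ≤ f z) (hfi : Integrable f) :
    Measure.pi (fun _ : ι => (volume : Measure ℂ).withDensity fun z => ENNReal.ofReal (f z)) =
      (volume : Measure (ι → ℂ)).withDensity fun x => ENNReal.ofReal (∏ n, f (x n)) := by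
  have : IsFiniteMeasure ((volume : Measure ℂ).withDensity fun z => ENNReal.ofReal (f z)) :=
    isFiniteMeasure_withDensity_ofReal hfi.2
  refine Measure.pi_eq fun s hs => ?_
  have hint : ∀ n, Integrable ((s n).indicator f) := fun n => hfi.indicator (hs n)
  have hnn : ∀ n z, 0 ≤ (s n).indicator f z := fun n z => indicator_nonneg (fun w _ => hf0 w) z
  rw [withDensity_apply _ (MeasurableSet.univ_pi hs), ← lintegral_indicator (.univ_pi hs)]
  have hpt : ∀ x : ι → ℂ, (univ.pi s).indicator (fun x => ENNReal.ofReal (∏ n, f (x n))) x =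
      ENNReal.ofReal (∏ n, (s n).indicator f (x n)) := by
    intro x
    by_cases hx : x ∈ univ.pi s
    · rw [indicator_of_mem hx]
      congr 1
      exact Finset.prod_congr rfl fun n _ => (indicator_of_mem (hx n (mem_univ n)) f).symm
    · rw [indicator_of_notMem hx]
      obtain ⟨n, hn⟩ : ∃ n, x n ∉ s n := by simpa [mem_univ_pi] using hx
      rw [Finset.prod_eq_zero (Finset.mem_univ n) (indicator_of_notMem hn f), ENNReal.ofReal_zero]
  simp_rw [hpt]
  rw [volume_pi, ← ofReal_integral_eq_lintegral_ofReal
    (Integrable.fintype_prod (f := fun n => (s n).indicator f) hint)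
    (Eventually.of_forall fun x => Finset.prod_nonneg fun n _ => hnn n _),
    integral_fintype_prod_eq_prod (fun n => (s n).indicator f),
    ENNReal.ofReal_prod_of_nonneg fun n _ => integral_nonneg (hnn n)]
  refine Finset.prod_congr rfl fun n _ => ?_
  rw [withDensity_apply _ (hs n), ← lintegral_indicator (hs n),
    ofReal_integral_eq_lintegral_ofReal (hint n) (Eventually.of_forall (hnn n))]
  refine lintegral_congr fun z => ?_
  by_cases hz : z ∈ s n <;> simp [hz]

/-- The density of `muBeta β`. -/
def siteDensity (β : ℝ) (z : ℂ) : ℝ :=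
  (1 + 2*β)/(Real.pi * (1 + Complex.normSq z) ^ (2 + 2*β))

theorem measurable_siteDensity (β : ℝ) : Measurable (siteDensity β) := by
  have : Measurable Complex.normSq := Complex.continuous_normSq.measurable
  unfold siteDensity
  fun_prop

theorem siteDensity_nonneg {β : ℝ} (hβ : 0 < β) (z : ℂ) : 0 ≤ siteDensity β z := by
  have := Complex.normSq_nonneg z
  unfold siteDensity
  positivity

theorem siteDensity_eq (β : ℝ) (z : ℂ) : siteDensity β z =
    (1 + 2*β) / Real.pi * Real.exp (-(2 + 2*β) * Real.log (1 + Complex.normSq z)) := by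
  have := Complex.normSq_nonneg z
  rw [siteDensity, Real.rpow_def_of_pos (by positivity), neg_mul, Real.exp_neg,
    mul_comm (Real.log _)]
  field_simp

theorem integrable_moment_siteDensity {β p : ℝ} (hβ : 0 < β) (hp : 0 ≤ p) (hp' : p ≤ 1 + β) :
    Integrable fun z : ℂ => ‖z‖ ^ (2 * p) * siteDensity β z := by
  have h := (integrable_rpow_neg_one_add_norm_sq (E := ℂ) (μ := volume) (r := 2 + 2 * β)
    (by simp [Complex.finrank_real_complex]; linarith)).const_mul ((1 + 2*β)/Real.pi)
  refine h.mono' ((Measurable.aestronglyMeasurable (by fun_prop)).mul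
    (measurable_siteDensity β).aestronglyMeasurable) (Eventually.of_forall fun z => ?_)
  rw [Real.norm_of_nonneg (mul_nonneg (by positivity) (siteDensity_nonneg hβ z)), siteDensity,
    Complex.normSq_eq_norm_sq]
  have h1 : ‖z‖ ^ (2 * p) ≤ (1 + ‖z‖ ^ 2) ^ (1 + β) := by
    rw [Real.rpow_mul (norm_nonneg z), Real.rpow_two]
    calc (‖z‖ ^ 2) ^ p ≤ (1 + ‖z‖ ^ 2) ^ p := by gcongr; linarith
      _ ≤ (1 + ‖z‖ ^ 2) ^ (1 + β) := Real.rpow_le_rpow_of_exponent_le (by nlinarith) hp'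
  have h2 : (1 + ‖z‖ ^ 2) ^ (2 + 2 * β) = (1 + ‖z‖ ^ 2) ^ (1 + β) * (1 + ‖z‖ ^ 2) ^ (1 + β) := by
    rw [← Real.rpow_add (by positivity)]; ring_nf
  have h3 : (1 + ‖z‖ ^ 2) ^ (-(2 + 2 * β) / 2) = ((1 + ‖z‖ ^ 2) ^ (1 + β))⁻¹ := by
    rw [← Real.rpow_neg (by positivity)]; ring_nf
  rw [h2, h3]
  set u := (1 + ‖z‖ ^ 2) ^ (1 + β) with hu
  have hu0 : 0 < u := by positivity
  calc ‖z‖ ^ (2 * p) * ((1 + 2 * β) / (Real.pi * (u * u)))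
      ≤ u * ((1 + 2 * β) / (Real.pi * (u * u))) := by gcongr
    _ = (1 + 2 * β) / Real.pi * u⁻¹ := by field_simp

theorem integrable_siteDensity {β : ℝ} (hβ : 0 < β) : Integrable (siteDensity β) := by
  simpa using integrable_moment_siteDensity (p := 0) hβ le_rfl (by linarith)

theorem muBeta_eq (β : ℝ) : muBeta β =
    (volume : Measure ℂ).withDensity fun z => ENNReal.ofReal (siteDensity β z) := rfl

theorem moment_muBeta_lt_top {β p : ℝ} (hβ : 0 < β) (hp : 0 ≤ p) (hp' : p ≤ 1 + β) :
    ∫⁻ z, ENNReal.ofReal (‖z‖ ^ (2 * p)) ∂muBeta β < ⊤ := by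
  rw [muBeta_eq, lintegral_withDensity_eq_lintegral_mul _
    (measurable_siteDensity β).ennreal_ofReal (by fun_prop)]
  refine lt_of_eq_of_lt (lintegral_congr fun z => ?_)
    (integrable_moment_siteDensity hβ hp hp').lintegral_lt_top
  rw [Pi.mul_apply, mul_comm, ← ENNReal.ofReal_mul (by positivity)]

section

variable {ι : Type*} [Fintype ι]

theorem pi_muBeta_eq {β : ℝ} (hβ : 0 < β) : Measure.pi (fun _ : ι => muBeta β) =
    (volume : Measure (ι → ℂ)).withDensity fun x => ENNReal.ofReal
      (((1 + 2*β) / Real.pi) ^ Fintype.card ι * Real.exp (-(2 + 2*β) * logMass x)) := by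
  simp_rw [muBeta_eq]
  rw [pi_withDensity_ofReal (siteDensity_nonneg hβ)
    (integrable_siteDensity hβ)]
  congr 1 with x
  simp_rw [siteDensity_eq, Finset.prod_mul_distrib, ← Real.exp_sum, ← Finset.mul_sum, logMass]
  rw [Finset.prod_const, Finset.card_univ]

theorem map_pi_muBeta_le {β : ℝ} (hβ : 0 < β) {T : (ι → ℂ) → ι → ℂ} (hT : Measurable T)
    (hmass : ∀ x, logMass (T x) = logMass x)
    (hvol : (volume : Measure (ι → ℂ)).map T ≤ volume) :
    (Measure.pi fun _ : ι => muBeta β).map T ≤ Measure.pi fun _ : ι => muBeta β := by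
  refine Measure.le_iff.2 fun s hs => ?_
  rw [Measure.map_apply hT hs, pi_muBeta_eq hβ, withDensity_apply _ (hT hs),
    withDensity_apply _ hs]
  set h : (ι → ℂ) → ℝ≥0∞ := fun x => ENNReal.ofReal
    (((1 + 2*β) / Real.pi) ^ Fintype.card ι * Real.exp (-(2 + 2*β) * logMass x)) with hh
  have hm : Measurable h := by
    have : Measurable (logMass (ι := ι)) := contDiff_logMass.continuous.measurable
    fun_prop
  calc ∫⁻ x in T ⁻¹' s, h x = ∫⁻ x in T ⁻¹' s, h (T x) := by simp only [hh, hmass]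
    _ = ∫⁻ x in s, h x ∂(volume : Measure (ι → ℂ)).map T := (setLIntegral_map hs hm hT).symm
    _ ≤ ∫⁻ x in s, h x := lintegral_mono' (Measure.restrict_mono le_rfl hvol) le_rfl

end

theorem IsWhiteNoise.isProbabilityMeasure_muBeta {β : ℝ} {μ : Measure (ℤ → ℂ)}
    (hμ : IsWhiteNoise β μ) : IsProbabilityMeasure (muBeta β) := by
  have := hμ.1
  have h := hμ.2 {0} (fun _ => univ) fun _ => MeasurableSet.univ
  simp only [mem_univ, implies_true, ofPred_true, measure_univ, Finset.prod_singleton] at h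
  exact ⟨h.symm⟩

theorem IsWhiteNoise.map_restrict {β : ℝ} {μ : Measure (ℤ → ℂ)} (hμ : IsWhiteNoise β μ)
    (F : Finset ℤ) :
    μ.map (fun a (n : F) => a n) = Measure.pi fun _ : F => muBeta β := by
  classical
  have := hμ.isProbabilityMeasure_muBeta
  symm
  refine Measure.pi_eq fun s hs => ?_
  rw [Measure.map_apply (by fun_prop) (MeasurableSet.univ_pi hs)]
  let A : ℤ → Set ℂ := fun n => if h : n ∈ F then s ⟨n, h⟩ else univ
  have hA : ∀ n : F, A n = s n := fun n => by simp [A]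
  have h := hμ.2 F A fun n => by
    by_cases hn : n ∈ F
    · simpa [A, hn] using hs ⟨n, hn⟩
    · simp [A, hn]
  rw [← Finset.prod_coe_sort] at h
  simp_rw [hA] at h
  rw [← h]
  congr 1
  ext a
  simp only [mem_preimage, mem_univ_pi, mem_ofPred_eq, ← hA, Subtype.forall]

/-- The sequence `α` satisfies the Ablowitz–Ladik equation at site `n` for all times. -/
def SolvesAt (α : ℤ → ℝ → ℂ) (n : ℤ) : Prop :=
  ∀ t, HasDerivAt (α n) (Complex.I * (1 + (Complex.normSq (α n t) : ℂ)) *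
    (α (n + 1) t + α (n - 1) t) - 2 * Complex.I * α n t) t

theorem alSolution_iff {α : ℤ → ℝ → ℂ} : ALSolution α ↔ ∀ n, SolvesAt α n := by
  refine forall_congr' fun n => forall_congr' fun t => ⟨?_, fun h => ⟨_, h, ?_⟩⟩
  · rintro ⟨d, hd, h⟩
    refine hd.congr_deriv ?_
    linear_combination (-Complex.I) * h + d * Complex.I_sq
  · linear_combination (((1 : ℂ) + (Complex.normSq (α n t) : ℂ)) * (α (n + 1) t + α (n - 1) t)
      - 2 * α n t) * Complex.I_sq

/-- The time reversal symmetry of the Ablowitz–Ladik system. -/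
def timeReversal (α : ℤ → ℝ → ℂ) (n : ℤ) (t : ℝ) : ℂ := (starRingEnd ℂ) (α n (-t))

theorem norm_timeReversal (α : ℤ → ℝ → ℂ) (n : ℤ) (t : ℝ) : ‖timeReversal α n t‖ = ‖α n (-t)‖ :=
  RCLike.norm_conj _

theorem SolvesAt.timeReversal {α : ℤ → ℝ → ℂ} {n : ℤ} (h : SolvesAt α n) :
    SolvesAt (timeReversal α) n := by
  intro t
  have h1 : HasDerivAt (fun s => α n (-s)) _ t := (h (-t)).scomp t (hasDerivAt_neg t)
  have h2 := Complex.conjCLE.toContinuousLinearMap.hasFDerivAt.comp_hasDerivAt t h1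
  refine h2.congr_deriv ?_
  simp only [ContinuousLinearEquiv.coe_coe, Complex.conjCLE_apply, _root_.timeReversal,
    Complex.normSq_conj]
  simp [show (starRingEnd ℂ) 2 = 2 from Complex.conj_ofNat 2]
  ring

theorem SolvesAt.continuous {α : ℤ → ℝ → ℂ} {n : ℤ} (h : SolvesAt α n) : Continuous (α n) :=
  continuous_iff_continuousAt.2 fun t => (h t).continuousAt

theorem SolvesAt.one_add_normSq_le {α : ℤ → ℝ → ℂ} {n : ℤ} (h : SolvesAt α n) {W : ℝ → ℝ} {T : ℝ}
    (hT : 0 ≤ T) (hW : Continuous W) (hαW : ∀ t ∈ Icc 0 T, ‖α n t‖ ^ 2 ≤ W t)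
    (hαW₁ : ∀ t ∈ Icc 0 T, ‖α (n + 1) t‖ ^ 2 ≤ W t)
    (hαW₂ : ∀ t ∈ Icc 0 T, ‖α (n - 1) t‖ ^ 2 ≤ W t) :
    1 + ‖α n T‖ ^ 2 ≤ (1 + ‖α n 0‖ ^ 2) * Real.exp (4 * ∫ s in 0..T, W s) := by
  have hpos : ∀ t, 0 < 1 + Complex.normSq (α n t) := fun t => by
    have := Complex.normSq_nonneg (α n t); positivity
  have hderiv : ∀ t, HasDerivAt (fun s => Real.log (1 + Complex.normSq (α n s))) _ t :=
    fun t => ((h t).normSq.const_add 1).log (hpos t).ne'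
  have key := intervalIntegral.sub_le_integral_of_hasDeriv_right_of_le (φ := fun s => 4 * W s) hT
    (fun t _ => (hderiv t).continuousAt.continuousWithinAt)
    (fun t _ => (hderiv t).hasDerivWithinAt) ((hW.const_mul 4).integrableOn_Icc)
    (fun t ht => by
      have ht' := Ioo_subset_Icc_self ht
      rw [div_le_iff₀ (hpos t)]
      have h0 := hαW t ht'
      have h1 := hαW₁ t ht'
      have h2 := hαW₂ t ht'
      rw [← Complex.normSq_eq_norm_sq, Complex.normSq_apply] at h0 h1 h2
      have hp := hpos t
      simp only [Complex.normSq_apply] at hp ⊢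
      simp only [Complex.sub_re, Complex.sub_im, Complex.mul_re, Complex.mul_im, Complex.I_re,
        Complex.I_im, Complex.add_re, Complex.add_im, Complex.one_re, Complex.one_im,
        Complex.ofReal_re, Complex.ofReal_im, Complex.re_ofNat, Complex.im_ofNat]
      set u := (α n t).re
      set v := (α n t).im
      set a := (α (n + 1) t).re
      set b := (α (n + 1) t).im
      set c := (α (n - 1) t).re
      set d := (α (n - 1) t).im
      have : -2 * u * (b + d) + 2 * v * (a + c) ≤ 4 * W t := by
        nlinarith [sq_nonneg (u + b), sq_nonneg (u + d), sq_nonneg (v - a), sq_nonneg (v - c)]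
      calc _ = (1 + (u * u + v * v)) * (-2 * u * (b + d) + 2 * v * (a + c)) := by ring
        _ ≤ (1 + (u * u + v * v)) * (4 * W t) := by gcongr
        _ = _ := by ring)
  rw [intervalIntegral.integral_const_mul] at key
  rw [← Complex.normSq_eq_norm_sq, ← Complex.normSq_eq_norm_sq,
    ← Real.log_le_log_iff (hpos T) (mul_pos (hpos 0) (Real.exp_pos _)),
    Real.log_mul (hpos 0).ne' (Real.exp_pos _).ne', Real.log_exp]
  linarith

theorem norm_alRhs_sub_le {a₀ a₁ a₂ b₀ b₁ b₂ : ℂ} {W D : ℝ} (hb₀ : ‖b₀‖ ^ 2 ≤ W)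
    (hb₁ : ‖b₁‖ ^ 2 ≤ W) (hb₂ : ‖b₂‖ ^ 2 ≤ W) (ha₀ : ‖a₀‖ ^ 2 ≤ W)
    (h₀ : ‖a₀ - b₀‖ ≤ D) (h₁ : ‖a₁ - b₁‖ ≤ D) (h₂ : ‖a₂ - b₂‖ ≤ D) :
    ‖(Complex.I * (1 + (Complex.normSq a₀ : ℂ)) * (a₁ + a₂) - 2 * Complex.I * a₀) -
      (Complex.I * (1 + (Complex.normSq b₀ : ℂ)) * (b₁ + b₂) - 2 * Complex.I * b₀)‖ ≤
      D * (6 * (1 + W)) := by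
  have hD : 0 ≤ D := (norm_nonneg _).trans h₀
  have hW : 0 ≤ W := (sq_nonneg _).trans hb₀
  have hs : ∀ z : ℂ, ‖z‖ ^ 2 ≤ W → ‖z‖ ≤ √W := fun z hz => Real.le_sqrt_of_sq_le hz
  have e : (Complex.I * (1 + (Complex.normSq a₀ : ℂ)) * (a₁ + a₂) - 2 * Complex.I * a₀) -
      (Complex.I * (1 + (Complex.normSq b₀ : ℂ)) * (b₁ + b₂) - 2 * Complex.I * b₀) =
      Complex.I * ((1 + (‖a₀‖ ^ 2 : ℝ) : ℂ) * ((a₁ - b₁) + (a₂ - b₂)) +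
        ((‖a₀‖ ^ 2 - ‖b₀‖ ^ 2 : ℝ) : ℂ) * (b₁ + b₂) - 2 * (a₀ - b₀)) := by
    rw [Complex.normSq_eq_norm_sq, Complex.normSq_eq_norm_sq]; push_cast; ring
  have n1 : ‖(1 + (‖a₀‖ ^ 2 : ℝ) : ℂ)‖ ≤ 1 + W := by
    rw [← Complex.ofReal_one, ← Complex.ofReal_add, Complex.norm_real,
      Real.norm_of_nonneg (by positivity)]
    linarith
  have n2 : ‖((‖a₀‖ ^ 2 - ‖b₀‖ ^ 2 : ℝ) : ℂ)‖ ≤ D * (2 * √W) := by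
    rw [Complex.norm_real, Real.norm_eq_abs, sq_sub_sq, abs_mul, mul_comm]
    gcongr
    · exact (abs_norm_sub_norm_le _ _).trans h₀
    · rw [abs_of_nonneg (by positivity)]; linarith [hs _ ha₀, hs _ hb₀]
  rw [e, norm_mul, Complex.norm_I, one_mul]
  calc _ ≤ (1 + W) * (D + D) + (D * (2 * √W)) * (√W + √W) + 2 * D := by
        refine (norm_sub_le _ _).trans (add_le_add ((norm_add_le _ _).trans (add_le_add ?_ ?_)) ?_)
        · rw [norm_mul]
          exact mul_le_mul n1 ((norm_add_le _ _).trans (add_le_add h₁ h₂)) (norm_nonneg _)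
            (by positivity)
        · rw [norm_mul]
          exact mul_le_mul n2 ((norm_add_le _ _).trans (add_le_add (hs _ hb₁) (hs _ hb₂)))
            (norm_nonneg _) (by positivity)
        · rw [norm_mul, Complex.norm_two]; gcongr
    _ = D * (2 * (1 + W) + 4 * (√W * √W) + 2) := by ring
    _ ≤ D * (6 * (1 + W)) := by
        rw [Real.mul_self_sqrt hW]
        gcongr
        linarith

theorem norm_sub_le_of_solvesAt {α β : ℤ → ℝ → ℂ} {M : ℕ} {T K : ℝ} {W : ℝ → ℝ}
    (hα : ∀ n : ℤ, n.natAbs ≤ M → SolvesAt α n) (hβ : ∀ n : ℤ, n.natAbs ≤ M → SolvesAt β n)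
    (h0 : ∀ n : ℤ, n.natAbs ≤ M → α n 0 = β n 0) (hW : Continuous W)
    (hαW : ∀ n : ℤ, n.natAbs ≤ M + 1 → ∀ t ∈ Icc 0 T, ‖α n t‖ ^ 2 ≤ W t)
    (hβW : ∀ n : ℤ, n.natAbs ≤ M + 1 → ∀ t ∈ Icc 0 T, ‖β n t‖ ^ 2 ≤ W t)
    (hK : ∀ n : ℤ, n.natAbs ≤ M → ∀ t ∈ Icc 0 T, ‖α n t - β n t‖ ≤ K) (j : ℕ) :
    ∀ n : ℤ, n.natAbs + j ≤ M → ∀ t ∈ Icc 0 T,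
      ‖α n t - β n t‖ ≤ K * ((∫ s in 0..t, 6 * (1 + W s)) ^ j / j.factorial) := by
  induction j with
  | zero => simpa using hK
  | succ j ih =>
    intro n hn
    set H : ℝ → ℝ := fun t => ∫ s in 0..t, 6 * (1 + W s) with hH
    have hH' : ∀ t, HasDerivAt H (6 * (1 + W t)) t := fun t =>
      intervalIntegral.integral_hasDerivAt_right (Continuous.intervalIntegrable (by fun_prop) _ _)
        (Continuous.stronglyMeasurableAtFilter (by fun_prop) _ _) (by fun_prop)
    have hB : ∀ t, HasDerivAt (fun t => K * (H t ^ (j + 1) / (j + 1).factorial))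
        (K * (H t ^ j / j.factorial) * (6 * (1 + W t))) t := fun t => by
      refine ((((hH' t).pow (j + 1)).div_const _).const_mul K).congr_deriv ?_
      rw [Nat.factorial_succ]
      push_cast
      field_simp
    refine image_norm_le_of_norm_deriv_right_le_deriv_boundary
      (fun t _ => ((hα n (by omega)).continuous.sub
        (hβ n (by omega)).continuous).continuousAt.continuousWithinAt)
      (fun t _ => ((hα n (by omega) t).sub (hβ n (by omega) t)).hasDerivWithinAt) ?_ hB ?_
    · simp [h0 n (by omega)]
    · intro t ht
      have ht' := Ico_subset_Icc_self ht
      exact norm_alRhs_sub_le (hβW _ (by omega) t ht') (hβW _ (by omega) t ht')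
        (hβW _ (by omega) t ht') (hαW _ (by omega) t ht') (ih _ (by omega) t ht')
        (ih _ (by omega) t ht') (ih _ (by omega) t ht')

/-- The weighted space-time moment appearing in the definition of good solutions. -/
def wMoment (p q T : ℝ) (α : ℤ → ℝ → ℂ) : ℝ≥0∞ :=
  ∫⁻ t in Icc (-T) T, ∑' n : ℤ, ENNReal.ofReal (jap n ^ (-q) * ‖α n t‖ ^ (2 * p))

theorem one_le_jap (n : ℤ) : 1 ≤ jap n := by
  rw [jap, Real.one_le_sqrt]
  nlinarith [sq_nonneg (n : ℝ)]

theorem jap_pos (n : ℤ) : 0 < jap n := one_pos.trans_le (one_le_jap n)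

theorem abs_le_jap (n : ℤ) : |(n : ℝ)| ≤ jap n := by
  refine Real.le_sqrt_of_sq_le ?_
  rw [sq_abs]; linarith

theorem jap_le (n : ℤ) : jap n ≤ 1 + |(n : ℝ)| := by
  refine Real.sqrt_le_iff.2 ⟨by positivity, ?_⟩
  nlinarith [abs_nonneg (n : ℝ), sq_abs (n : ℝ)]

theorem jap_le_of_natAbs_le {n : ℤ} {M : ℕ} (h : n.natAbs ≤ M) : jap n ≤ 1 + M := by
  have : |(n : ℝ)| ≤ M := by
    rw [← Int.cast_abs, Int.abs_eq_natAbs]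
    exact_mod_cast h
  linarith [jap_le n]

theorem wMoment_timeReversal (p q T : ℝ) (α : ℤ → ℝ → ℂ) :
    wMoment p q T (timeReversal α) = wMoment p q T α := by
  simp only [wMoment, norm_timeReversal]
  have h := (Measure.measurePreserving_neg (volume : Measure ℝ)).setLIntegral_comp_preimage_emb
    (MeasurableEquiv.neg ℝ).measurableEmbedding
    (fun t => ∑' n : ℤ, ENNReal.ofReal (jap n ^ (-q) * ‖α n t‖ ^ (2 * p))) (Icc (-T) T)
  simpa using h

/-- A majorant of `‖α m t‖ ^ 2`, `|m| ≤ M`, whose time integral is controlled by `wMoment`. -/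
def majorant (p lam : ℝ) (M : ℕ) (α : ℤ → ℝ → ℂ) (t : ℝ) : ℝ :=
  lam + lam ^ (1 - p) * ∑ m ∈ Finset.Icc (-(M : ℤ)) M, ‖α m t‖ ^ (2 * p)

theorem le_add_rpow_mul_rpow {x lam p : ℝ} (hx : 0 ≤ x) (hlam : 0 < lam) (hp : 1 ≤ p) :
    x ≤ lam + lam ^ (1 - p) * x ^ p := by
  rcases le_total x lam with h | h
  · have : 0 ≤ lam ^ (1 - p) * x ^ p := by positivity
    linarith
  · have hx' : 0 < x := hlam.trans_le h
    have h1 : x ^ (1 - p) ≤ lam ^ (1 - p) := Real.rpow_le_rpow_of_nonpos hlam h (by linarith)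
    have h2 : x = x ^ (1 - p) * x ^ p := by rw [← Real.rpow_add hx']; simp
    calc x = x ^ (1 - p) * x ^ p := h2
      _ ≤ lam ^ (1 - p) * x ^ p := by gcongr
      _ ≤ _ := by linarith

theorem sq_norm_le_majorant {p lam : ℝ} (hp : 1 ≤ p) (hlam : 0 < lam) {M : ℕ} (α : ℤ → ℝ → ℂ)
    (t : ℝ) {m : ℤ} (hm : m.natAbs ≤ M) : ‖α m t‖ ^ 2 ≤ majorant p lam M α t := by
  refine (le_add_rpow_mul_rpow (sq_nonneg _) hlam hp).trans ?_
  rw [majorant, ← Real.rpow_two, ← Real.rpow_mul (norm_nonneg _)]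
  gcongr
  exact Finset.single_le_sum (f := fun m => ‖α m t‖ ^ (2 * p)) (fun _ _ => by positivity)
    (Finset.mem_Icc.2 (by omega))

theorem majorant_nonneg {p lam : ℝ} (hlam : 0 < lam) (M : ℕ) (α : ℤ → ℝ → ℂ) (t : ℝ) :
    0 ≤ majorant p lam M α t := by
  unfold majorant; positivity

theorem continuous_majorant {p lam : ℝ} (hp : 0 ≤ p) {M : ℕ} {α : ℤ → ℝ → ℂ}
    (hα : ∀ n, Continuous (α n)) : Continuous (majorant p lam M α) := by
  unfold majorant
  refine continuous_const.add (continuous_const.mul (continuous_finsetSum _ fun m _ => ?_))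
  exact (hα m).norm.rpow_const fun _ => Or.inr (by positivity)

theorem integral_majorant_le {p q r D T l : ℝ} (hp : 1 ≤ p) (hq : 0 ≤ q) {M : ℕ} {α : ℤ → ℝ → ℂ}
    (hα : ∀ n, Continuous (α n)) (hT : 0 ≤ T) (hl : 1 + M ≤ l) (hD : 0 ≤ D)
    (h : wMoment p q T α ≤ ENNReal.ofReal (D * l ^ (r - q))) :
    ∫ t in 0..T, majorant p (l ^ (r / p)) M α t ≤ (T + D) * l ^ (r / p) := by
  have hl0 : 0 < l := by
    have : (0 : ℝ) ≤ M := by positivity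
    linarith
  set S : ℝ → ℝ := fun t => ∑ m ∈ Finset.Icc (-(M : ℤ)) M, jap m ^ (-q) * ‖α m t‖ ^ (2 * p) with hS
  have hcont : ∀ m, Continuous fun t => ‖α m t‖ ^ (2 * p) := fun m =>
    (hα m).norm.rpow_const fun _ => Or.inr (by positivity)
  have hScont : Continuous S := continuous_finsetSum _ fun m _ => continuous_const.mul (hcont m)
  have hSnn : ∀ t, 0 ≤ S t := fun t => Finset.sum_nonneg fun m _ =>
    mul_nonneg (Real.rpow_nonneg (jap_pos m).le _) (by positivity)
  have hSint : ∫ t in 0..T, S t ≤ D * l ^ (r - q) := by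
    rw [← ENNReal.ofReal_le_ofReal_iff (by positivity)]
    refine le_trans ?_ h
    rw [intervalIntegral.integral_of_le hT, ofReal_integral_eq_lintegral_ofReal
      (hScont.integrableOn_Icc.mono_set Ioc_subset_Icc_self) (Eventually.of_forall hSnn)]
    refine lintegral_mono' (Measure.restrict_mono (Ioc_subset_Icc_self.trans
      (Icc_subset_Icc_left (by linarith))) le_rfl)
      fun t => ?_
    rw [hS, ENNReal.ofReal_sum_of_nonneg fun m _ =>
      mul_nonneg (Real.rpow_nonneg (jap_pos m).le _) (by positivity)]
    exact ENNReal.sum_le_tsum _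
  have hmaj : ∀ t, majorant p (l ^ (r / p)) M α t ≤
      l ^ (r / p) + (l ^ (r / p)) ^ (1 - p) * l ^ q * S t := by
    intro t
    rw [majorant, mul_assoc, show l ^ q * S t = ∑ m ∈ Finset.Icc (-(M : ℤ)) M,
      l ^ q * (jap m ^ (-q) * ‖α m t‖ ^ (2 * p)) from Finset.mul_sum _ _ _]
    refine add_le_add le_rfl (mul_le_mul_of_nonneg_left (Finset.sum_le_sum fun m hm => ?_)
      (by positivity))
    have hj : jap m ≤ l :=
      (jap_le_of_natAbs_le (M := M) (by rw [Finset.mem_Icc] at hm; omega)).trans hl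
    have : 1 ≤ l ^ q * jap m ^ (-q) := by
      rw [Real.rpow_neg (jap_pos m).le, ← div_eq_mul_inv,
        one_le_div (Real.rpow_pos_of_pos (jap_pos m) q)]
      exact Real.rpow_le_rpow (jap_pos m).le hj hq
    rw [← mul_assoc]
    exact le_mul_of_one_le_left (by positivity) this
  have hpow : (l ^ (r / p)) ^ (1 - p) * l ^ q * l ^ (r - q) = l ^ (r / p) := by
    rw [← Real.rpow_mul hl0.le, ← Real.rpow_add hl0, ← Real.rpow_add hl0]
    congr 1
    field_simp
    ring
  calc ∫ t in 0..T, majorant p (l ^ (r / p)) M α t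
      ≤ ∫ t in 0..T, (l ^ (r / p) + (l ^ (r / p)) ^ (1 - p) * l ^ q * S t) :=
        intervalIntegral.integral_mono_on hT
          ((continuous_majorant (by linarith) hα).intervalIntegrable _ _)
          (Continuous.intervalIntegrable (by fun_prop) _ _) fun t _ => hmaj t
    _ = T * l ^ (r / p) + (l ^ (r / p)) ^ (1 - p) * l ^ q * ∫ t in 0..T, S t := by
        rw [intervalIntegral.integral_add (Continuous.intervalIntegrable (by fun_prop) _ _)
          (Continuous.intervalIntegrable (by fun_prop) _ _), intervalIntegral.integral_const_mul]
        simp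
    _ ≤ T * l ^ (r / p) + (l ^ (r / p)) ^ (1 - p) * l ^ q * (D * l ^ (r - q)) := by gcongr
    _ = T * l ^ (r / p) + D * ((l ^ (r / p)) ^ (1 - p) * l ^ q * l ^ (r - q)) := by ring
    _ = (T + D) * l ^ (r / p) := by rw [hpow]; ring

theorem eventually_stability_constant_le {A c C T θ : ℝ} (hA : 0 ≤ A) (hc : 0 ≤ c) (hC : 0 ≤ C)
    (hT : 0 ≤ T) (hθ : 0 ≤ θ) (hθ1 : θ < 1) :
    ∀ᶠ j : ℕ in atTop, 2 * ((1 + A * Real.exp (c * (2 * j + 2))) *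
      Real.exp (4 * (C * (2 * j + 2 : ℝ) ^ θ))) *
      ((6 * T + 6 * (C * (2 * j + 2 : ℝ) ^ θ)) ^ j / j.factorial) ≤ (1 / 2) ^ j := by
  set Q := 2 * (1 + A) * Real.exp (4 * c + 16 * C) with hQ
  have hlim : Tendsto (fun j : ℕ => Q * Real.exp 1 *
      (6 * T * (j : ℝ)⁻¹ + 6 * C * 4 ^ θ * (j : ℝ) ^ (-(1 - θ)))) atTop (𝓝 0) := by
    have h1 : Tendsto (fun j : ℕ => (j : ℝ)⁻¹) atTop (𝓝 0) := tendsto_inv_atTop_nhds_zero_nat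
    have h2 : Tendsto (fun j : ℕ => (j : ℝ) ^ (-(1 - θ))) atTop (𝓝 0) :=
      (tendsto_rpow_neg_atTop (by linarith)).comp tendsto_natCast_atTop_atTop
    simpa using ((h1.const_mul (6 * T)).add (h2.const_mul (6 * C * 4 ^ θ))).const_mul
      (Q * Real.exp 1)
  filter_upwards [hlim.eventually_le_const (show (0 : ℝ) < 1 / 2 by norm_num),
    eventually_ge_atTop 1] with j hj hj1
  have hj1' : (1 : ℝ) ≤ j := by exact_mod_cast hj1
  have hj0 : (0 : ℝ) < j := by linarith
  have hl : (2 * j + 2 : ℝ) ≤ 4 * j := by linarith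
  have hlθ : (2 * j + 2 : ℝ) ^ θ ≤ 4 * j := by
    refine le_trans ?_ hl
    simpa using Real.rpow_le_rpow_of_exponent_le (show (1 : ℝ) ≤ 2 * j + 2 by linarith) hθ1.le
  have hpre : 2 * ((1 + A * Real.exp (c * (2 * j + 2))) *
      Real.exp (4 * (C * (2 * j + 2 : ℝ) ^ θ))) ≤ Q ^ j := by
    calc 2 * ((1 + A * Real.exp (c * (2 * j + 2))) * Real.exp (4 * (C * (2 * j + 2 : ℝ) ^ θ)))
        ≤ 2 * ((1 + A) * Real.exp (c * (4 * j)) * Real.exp (4 * (C * (4 * j)))) := by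
          gcongr
          have h1 : 1 ≤ Real.exp (c * (4 * j)) := Real.one_le_exp (by positivity)
          have h2 : Real.exp (c * (2 * j + 2)) ≤ Real.exp (c * (4 * j)) := by gcongr
          nlinarith
      _ = 2 * (1 + A) * Real.exp (4 * c + 16 * C) ^ j := by
          rw [← Real.exp_nat_mul, mul_assoc, mul_assoc, ← Real.exp_add]; ring_nf
      _ ≤ (2 * (1 + A)) ^ j * Real.exp (4 * c + 16 * C) ^ j := by
          gcongr
          exact le_self_pow₀ (by linarith) (by omega)
      _ = Q ^ j := (mul_pow _ _ _).symm
  set X := 6 * T + 6 * (C * (2 * j + 2 : ℝ) ^ θ) with hX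
  have hX0 : 0 ≤ X := by positivity
  have hXj : X / j ≤ 6 * T * (j : ℝ)⁻¹ + 6 * C * 4 ^ θ * (j : ℝ) ^ (-(1 - θ)) := by
    have e : (j : ℝ) ^ (-(1 - θ)) = (j : ℝ) ^ θ * (j : ℝ)⁻¹ := by
      rw [← Real.rpow_neg_one, ← Real.rpow_add hj0]; ring_nf
    have h4 : (2 * j + 2 : ℝ) ^ θ ≤ 4 ^ θ * (j : ℝ) ^ θ := by
      rw [← Real.mul_rpow (by norm_num) hj0.le]
      gcongr
    rw [e, div_eq_mul_inv]
    calc X * (j : ℝ)⁻¹ ≤ (6 * T + 6 * (C * (4 ^ θ * (j : ℝ) ^ θ))) * (j : ℝ)⁻¹ := by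
          rw [hX]; gcongr
      _ = _ := by ring
  have hfac : X ^ j / j.factorial ≤ (Real.exp 1 * (X / j)) ^ j := by
    have h1 : (j : ℝ) ^ j / j.factorial ≤ Real.exp 1 ^ j := by
      simpa [← Real.exp_nat_mul] using Real.pow_div_factorial_le_exp (j : ℝ) hj0.le j
    calc X ^ j / j.factorial = ((j : ℝ) ^ j / j.factorial) * (X / j) ^ j := by
          rw [div_pow]; field_simp
      _ ≤ Real.exp 1 ^ j * (X / j) ^ j := by gcongr
      _ = _ := by rw [mul_pow]
  have hQ0 : 0 ≤ Q := by positivity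
  calc _ ≤ Q ^ j * (Real.exp 1 * (X / j)) ^ j := by gcongr
    _ = (Q * Real.exp 1 * (X / j)) ^ j := by rw [← mul_pow]; ring
    _ ≤ (1 / 2) ^ j := by
        gcongr
        refine le_trans ?_ hj
        gcongr

/-- Quantitative control of a sequence which solves the Ablowitz–Ladik equation at the sites
`|n| ≤ 2 * j`, on the time interval `[-T, T]`. -/
structure IsControlled (p q r A c T D : ℝ) (j : ℕ) (α : ℤ → ℝ → ℂ) : Prop where
  continuous : ∀ n, Continuous (α n)
  solvesAt : ∀ n : ℤ, n.natAbs ≤ 2 * j → SolvesAt α n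
  initial : ∀ n : ℤ, n.natAbs ≤ 2 * j → ‖α n 0‖ ^ 2 ≤ A * Real.exp (c * (2 * j + 2))
  moment : wMoment p q T α ≤ ENNReal.ofReal (D * (2 * j + 2 : ℝ) ^ (r - q))

theorem continuous_timeReversal {α : ℤ → ℝ → ℂ} (h : ∀ n, Continuous (α n)) (n : ℤ) :
    Continuous (timeReversal α n) :=
  Complex.continuous_conj.comp ((h n).comp continuous_neg)

theorem IsControlled.timeReversal {p q r A c T D : ℝ} {j : ℕ} {α : ℤ → ℝ → ℂ}
    (h : IsControlled p q r A c T D j α) : IsControlled p q r A c T D j (timeReversal α) where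
  continuous := continuous_timeReversal h.continuous
  solvesAt n hn := (h.solvesAt n hn).timeReversal
  initial n hn := by simpa [norm_timeReversal] using h.initial n hn
  moment := by simpa only [wMoment_timeReversal] using h.moment

section

variable {p q r A c T D : ℝ} {j : ℕ} {α : ℤ → ℝ → ℂ}

theorem IsControlled.one_add_sq_le_of_nonneg (h : IsControlled p q r A c T D j α) (hp : 1 ≤ p)
    (hq : 0 ≤ q) (hD : 0 ≤ D) {n : ℤ} (hn : n.natAbs ≤ 2 * j) {t : ℝ} (ht : t ∈ Icc 0 T) :
    1 + ‖α n t‖ ^ 2 ≤ (1 + A * Real.exp (c * (2 * j + 2))) *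
      Real.exp (4 * ((T + D) * (2 * j + 2 : ℝ) ^ (r / p))) := by
  set l : ℝ := 2 * j + 2 with hl
  have hl0 : 0 < l := by positivity
  have hlam : 0 < l ^ (r / p) := by positivity
  have hW := continuous_majorant (p := p) (lam := l ^ (r / p)) (M := 2 * j + 1) (by linarith)
    h.continuous
  have hle : ∀ m : ℤ, m.natAbs ≤ 2 * j + 1 → ∀ s ∈ Icc 0 t, ‖α m s‖ ^ 2 ≤
      majorant p (l ^ (r / p)) (2 * j + 1) α s := fun m hm s _ =>
    sq_norm_le_majorant hp hlam α s hm
  refine ((h.solvesAt n hn).one_add_normSq_le ht.1 hW (hle _ (by omega)) (hle _ (by omega))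
    (hle _ (by omega))).trans ?_
  have h0 := h.initial n hn
  have hint : ∫ s in 0..t, majorant p (l ^ (r / p)) (2 * j + 1) α s ≤ (T + D) * l ^ (r / p) := by
    refine le_trans ?_ (integral_majorant_le (M := 2 * j + 1) hp hq h.continuous (ht.1.trans ht.2)
      (by push_cast; linarith) hD h.moment)
    exact intervalIntegral.integral_mono_interval le_rfl ht.1 ht.2
      (Eventually.of_forall fun s => majorant_nonneg hlam _ α s) (hW.intervalIntegrable _ _)
  have : 0 ≤ ‖α n 0‖ ^ 2 := sq_nonneg _
  gcongr
  linarith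

theorem IsControlled.one_add_sq_le (h : IsControlled p q r A c T D j α) (hp : 1 ≤ p)
    (hq : 0 ≤ q) (hD : 0 ≤ D) {n : ℤ} (hn : n.natAbs ≤ 2 * j) {t : ℝ} (ht : t ∈ Icc (-T) T) :
    1 + ‖α n t‖ ^ 2 ≤ (1 + A * Real.exp (c * (2 * j + 2))) *
      Real.exp (4 * ((T + D) * (2 * j + 2 : ℝ) ^ (r / p))) := by
  rcases le_total 0 t with h0 | h0
  · exact h.one_add_sq_le_of_nonneg hp hq hD hn ⟨h0, ht.2⟩
  · simpa [norm_timeReversal] using h.timeReversal.one_add_sq_le_of_nonneg hp hq hD hn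
      (t := -t) ⟨by linarith, by linarith [ht.1]⟩

end

theorem eventually_norm_sub_le_of_nonneg {p₁ q₁ r₁ p₂ q₂ r₂ A c T D : ℝ} (hp₁ : 1 ≤ p₁)
    (hq₁ : 0 ≤ q₁) (hr₁ : 0 ≤ r₁) (hr₁' : r₁ < p₁) (hp₂ : 1 ≤ p₂) (hq₂ : 0 ≤ q₂)
    (hr₂' : r₂ < p₂) (hA : 0 ≤ A) (hc : 0 ≤ c) (hT : 0 ≤ T) (hD : 0 ≤ D) :
    ∀ᶠ j : ℕ in atTop, ∀ α β : ℤ → ℝ → ℂ, IsControlled p₁ q₁ r₁ A c T D j α →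
      IsControlled p₂ q₂ r₂ A c T D j β → (∀ n : ℤ, n.natAbs ≤ 2 * j → α n 0 = β n 0) →
      ∀ n : ℤ, n.natAbs ≤ j → ∀ t ∈ Icc 0 T, ‖α n t - β n t‖ ≤ (1 / 2) ^ j := by
  set θ := max (r₁ / p₁) (r₂ / p₂) with hθ
  have hθ0 : 0 ≤ θ := le_max_of_le_left (by positivity)
  have hθ1 : θ < 1 := max_lt ((div_lt_one (by linarith)).2 hr₁') ((div_lt_one (by linarith)).2 hr₂')
  filter_upwards [eventually_stability_constant_le hA hc (C := 2 * (T + D)) (by positivity) hT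
    hθ0 hθ1] with j hj α β hα hβ h0 n hn t ht
  set l : ℝ := 2 * j + 2 with hl
  have hl1 : 1 ≤ l := by rw [hl]; linarith [(Nat.cast_nonneg j : (0 : ℝ) ≤ j)]
  have hl0 : 0 < l := by positivity
  have hlam₁ : 0 < l ^ (r₁ / p₁) := by positivity
  have hlam₂ : 0 < l ^ (r₂ / p₂) := by positivity
  have hθ₁ : l ^ (r₁ / p₁) ≤ l ^ θ := Real.rpow_le_rpow_of_exponent_le hl1 (le_max_left _ _)
  have hθ₂ : l ^ (r₂ / p₂) ≤ l ^ θ := Real.rpow_le_rpow_of_exponent_le hl1 (le_max_right _ _)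
  set W₁ := majorant p₁ (l ^ (r₁ / p₁)) (2 * j + 1) α
  set W₂ := majorant p₂ (l ^ (r₂ / p₂)) (2 * j + 1) β
  have hW₁ : Continuous W₁ := continuous_majorant (by linarith) hα.continuous
  have hW₂ : Continuous W₂ := continuous_majorant (by linarith) hβ.continuous
  have hW₁0 : ∀ s, 0 ≤ W₁ s := majorant_nonneg hlam₁ _ α
  have hW₂0 : ∀ s, 0 ≤ W₂ s := majorant_nonneg hlam₂ _ β
  set E := (1 + A * Real.exp (c * l)) * Real.exp (4 * (2 * (T + D) * l ^ θ)) with hE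
  have hK : ∀ (p r : ℝ) (γ : ℤ → ℝ → ℂ) (m : ℤ) (s : ℝ), l ^ (r / p) ≤ l ^ θ →
      1 + ‖γ m s‖ ^ 2 ≤ (1 + A * Real.exp (c * l)) * Real.exp (4 * ((T + D) * l ^ (r / p))) →
      ‖γ m s‖ ≤ E := by
    intro p r γ m s hle h
    have h1 : (1 + A * Real.exp (c * l)) * Real.exp (4 * ((T + D) * l ^ (r / p))) ≤ E := by
      rw [hE]
      have : (T + D) * l ^ (r / p) ≤ 2 * (T + D) * l ^ θ := by gcongr; linarith
      gcongr
    nlinarith [sq_nonneg (‖γ m s‖ - 1)]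
  have key := norm_sub_le_of_solvesAt (K := 2 * E) (T := T) hα.solvesAt hβ.solvesAt h0
    (hW₁.add hW₂)
    (fun m hm s _ => (sq_norm_le_majorant hp₁ hlam₁ α s hm).trans (le_add_of_nonneg_right (hW₂0 s)))
    (fun m hm s _ => (sq_norm_le_majorant hp₂ hlam₂ β s hm).trans (le_add_of_nonneg_left (hW₁0 s)))
    (fun m hm s hs => by
      have h1 := hK p₁ r₁ α m s hθ₁ (hα.one_add_sq_le_of_nonneg hp₁ hq₁ hD hm hs)
      have h2 := hK p₂ r₂ β m s hθ₂ (hβ.one_add_sq_le_of_nonneg hp₂ hq₂ hD hm hs)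
      linarith [norm_sub_le (α m s) (β m s)]) j n (by omega) t ht
  refine key.trans (le_trans ?_ hj)
  have hint0 : 0 ≤ ∫ s in 0..t, 6 * (1 + (W₁ s + W₂ s)) :=
    intervalIntegral.integral_nonneg ht.1 fun s _ => by linarith [hW₁0 s, hW₂0 s]
  have hint : ∫ s in 0..t, 6 * (1 + (W₁ s + W₂ s)) ≤ 6 * T + 6 * (2 * (T + D) * l ^ θ) := by
    calc ∫ s in 0..t, 6 * (1 + (W₁ s + W₂ s)) ≤ ∫ s in 0..T, 6 * (1 + (W₁ s + W₂ s)) :=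
          intervalIntegral.integral_mono_interval le_rfl ht.1 ht.2
            (Eventually.of_forall fun s => show (0 : ℝ) ≤ 6 * (1 + (W₁ s + W₂ s)) by
              linarith [hW₁0 s, hW₂0 s])
            (Continuous.intervalIntegrable (by fun_prop) _ _)
      _ = 6 * T + 6 * ((∫ s in 0..T, W₁ s) + ∫ s in 0..T, W₂ s) := by
          rw [intervalIntegral.integral_const_mul, intervalIntegral.integral_add
            (Continuous.intervalIntegrable (by fun_prop) _ _)
            (Continuous.intervalIntegrable (by fun_prop) _ _), intervalIntegral.integral_add
            (Continuous.intervalIntegrable (by fun_prop) _ _)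
            (Continuous.intervalIntegrable (by fun_prop) _ _)]
          simp
          ring
      _ ≤ 6 * T + 6 * ((T + D) * l ^ (r₁ / p₁) + (T + D) * l ^ (r₂ / p₂)) := by
          have h1 := integral_majorant_le hp₁ hq₁ (M := 2 * j + 1) hα.continuous hT
            (by push_cast; linarith) hD hα.moment
          have h2 := integral_majorant_le hp₂ hq₂ (M := 2 * j + 1) hβ.continuous hT
            (by push_cast; linarith) hD hβ.moment
          gcongr
      _ ≤ 6 * T + 6 * ((T + D) * l ^ θ + (T + D) * l ^ θ) := by gcongr
      _ = _ := by ring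
  simp only [Pi.add_apply]
  gcongr

/-- Two controlled solutions with the same initial data on `|n| ≤ 2 * j` are exponentially close
on `|n| ≤ j`. -/
theorem eventually_norm_sub_le {p₁ q₁ r₁ p₂ q₂ r₂ A c T D : ℝ} (hp₁ : 1 ≤ p₁)
    (hq₁ : 0 ≤ q₁) (hr₁ : 0 ≤ r₁) (hr₁' : r₁ < p₁) (hp₂ : 1 ≤ p₂) (hq₂ : 0 ≤ q₂)
    (hr₂' : r₂ < p₂) (hA : 0 ≤ A) (hc : 0 ≤ c) (hT : 0 ≤ T) (hD : 0 ≤ D) :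
    ∀ᶠ j : ℕ in atTop, ∀ α β : ℤ → ℝ → ℂ, IsControlled p₁ q₁ r₁ A c T D j α →
      IsControlled p₂ q₂ r₂ A c T D j β → (∀ n : ℤ, n.natAbs ≤ 2 * j → α n 0 = β n 0) →
      ∀ n : ℤ, n.natAbs ≤ j → ∀ t ∈ Icc (-T) T, ‖α n t - β n t‖ ≤ (1 / 2) ^ j := by
  filter_upwards [eventually_norm_sub_le_of_nonneg hp₁ hq₁ hr₁ hr₁' hp₂ hq₂ hr₂' hA hc hT hD]
    with j hj α β hα hβ h0 n hn t ht
  rcases le_total 0 t with ht0 | ht0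
  · exact hj α β hα hβ h0 n hn t ⟨ht0, ht.2⟩
  · have := hj _ _ hα.timeReversal hβ.timeReversal
      (fun m hm => by simp [timeReversal, h0 m hm]) n hn (-t) ⟨by linarith, by linarith [ht.1]⟩
    rw [timeReversal, timeReversal, neg_neg, ← map_sub, RCLike.norm_conj] at this
    exact this

theorem IsControlled.of_solvesAt {p q r A c T D : ℝ} {α : ℤ → ℝ → ℂ} (hα : ∀ n, SolvesAt α n)
    (hA : 0 ≤ A) (hc : 0 ≤ c) (h0 : ∀ n, ‖α n 0‖ ^ 2 ≤ A * Real.exp (c * jap n)) {j : ℕ}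
    (hm : wMoment p q T α ≤ ENNReal.ofReal (D * (2 * j + 2 : ℝ) ^ (r - q))) :
    IsControlled p q r A c T D j α where
  continuous n := (hα n).continuous
  solvesAt n _ := hα n
  initial n hn := by
    refine (h0 n).trans ?_
    have := jap_le_of_natAbs_le hn
    push_cast at this
    gcongr
    linarith
  moment := hm

theorem exists_initial_bound {α : ℤ → ℝ → ℂ} {c : ℝ}
    (h : (⨆ t ∈ Icc (-1 : ℝ) 1, ∑' n : ℤ,
      ENNReal.ofReal (Real.exp (-(c * jap n)) * ‖α n t‖ ^ 2)) < ⊤) :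
    ∃ A, 0 ≤ A ∧ ∀ n, ‖α n 0‖ ^ 2 ≤ A * Real.exp (c * jap n) := by
  set S := ∑' n : ℤ, ENNReal.ofReal (Real.exp (-(c * jap n)) * ‖α n 0‖ ^ 2) with hS
  have hS' : S < ⊤ := lt_of_le_of_lt (le_iSup₂ (f := fun (t : ℝ) (_ : t ∈ Icc (-1 : ℝ) 1) =>
    ∑' n : ℤ, ENNReal.ofReal (Real.exp (-(c * jap n)) * ‖α n t‖ ^ 2)) 0 (by simp)) h
  refine ⟨S.toReal, ENNReal.toReal_nonneg, fun n => ?_⟩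
  have h1 := (ENNReal.ofReal_le_iff_le_toReal hS'.ne).1 (ENNReal.le_tsum (f := fun n : ℤ =>
    ENNReal.ofReal (Real.exp (-(c * jap n)) * ‖α n 0‖ ^ 2)) n)
  rwa [Real.exp_neg, inv_mul_le_iff₀ (Real.exp_pos _), mul_comm] at h1

theorem IsGoodALSolution.ext {α β : ℤ → ℝ → ℂ} (hα : IsGoodALSolution α) (hβ : IsGoodALSolution β)
    (h0 : ∀ n, α n 0 = β n 0) : α = β := by
  obtain ⟨hα, ⟨p₁, q₁, hq₁, hp₁, hm₁⟩, c, hc, hi⟩ := hα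
  obtain ⟨hβ, ⟨p₂, q₂, hq₂, hp₂, hm₂⟩, -⟩ := hβ
  obtain ⟨A, hA, hi⟩ := exists_initial_bound (hi 1 one_pos)
  rw [alSolution_iff] at hα hβ
  change ∀ T > 0, wMoment p₁ q₁ T α < ⊤ at hm₁
  change ∀ T > 0, wMoment p₂ q₂ T β < ⊤ at hm₂
  funext n t
  set T := |t| + 1 with hT
  have hT0 : 0 < T := by positivity
  set D := (wMoment p₁ q₁ T α).toReal + (wMoment p₂ q₂ T β).toReal with hD
  have hD₁ : wMoment p₁ q₁ T α ≤ ENNReal.ofReal D := by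
    rw [ENNReal.le_ofReal_iff_toReal_le (hm₁ T hT0).ne (by positivity)]
    exact le_add_of_nonneg_right ENNReal.toReal_nonneg
  have hD₂ : wMoment p₂ q₂ T β ≤ ENNReal.ofReal D := by
    rw [ENNReal.le_ofReal_iff_toReal_le (hm₂ T hT0).ne (by positivity)]
    exact le_add_of_nonneg_left ENNReal.toReal_nonneg
  have key := eventually_norm_sub_le (q₁ := q₁) (q₂ := q₂) (r₁ := q₁) (r₂ := q₂)
    (hq₁.trans hp₁).le (by linarith)
    (by linarith) hp₁ (hq₂.trans hp₂).le (by linarith) hp₂ hA hc.le hT0.le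
    (show 0 ≤ D by positivity)
  have hlim : Tendsto (fun j : ℕ => ((1 : ℝ) / 2) ^ j) atTop (𝓝 0) :=
    tendsto_pow_atTop_nhds_zero_of_lt_one (by norm_num) (by norm_num)
  have hle : ‖α n t - β n t‖ ≤ 0 := by
    refine ge_of_tendsto hlim ?_
    filter_upwards [key, eventually_ge_atTop n.natAbs] with j hj hjn
    exact hj α β (.of_solvesAt hα hA hc.le hi (by simpa using hD₁))
      (.of_solvesAt hβ hA hc.le (fun m => h0 m ▸ hi m) (by simpa using hD₂)) (fun m _ => h0 m)
      n hjn t (abs_le.1 (by linarith))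
  exact sub_eq_zero.1 (norm_le_zero_iff.1 hle)

theorem exists_tendstoLocallyUniformly {f : ℕ → ℝ → ℂ}
    (h : ∀ T > 0, ∀ᶠ k in atTop, ∀ t ∈ Icc (-T) T, ‖f k t - f (k + 1) t‖ ≤ (1 / 2) ^ k) :
    ∃ g : ℝ → ℂ, TendstoLocallyUniformly f g atTop := by
  have hshift : ∀ T > 0, ∃ k₀ : ℕ, ∀ t ∈ Icc (-T) T, ∀ m : ℕ,
      dist (f (m + k₀) t) (f (m + 1 + k₀) t) ≤ (1 / 2) ^ k₀ * (1 / 2) ^ m := by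
    intro T hT
    obtain ⟨k₀, hk₀⟩ := eventually_atTop.1 (h T hT)
    refine ⟨k₀, fun t ht m => ?_⟩
    rw [dist_eq_norm, ← pow_add, add_comm k₀, add_right_comm m 1]
    exact hk₀ _ (by omega) t ht
  have hlim : ∀ t, ∃ z, Tendsto (fun k => f k t) atTop (𝓝 z) := fun t => by
    obtain ⟨k₀, hk₀⟩ := hshift (|t| + 1) (by positivity)
    obtain ⟨z, hz⟩ := cauchySeq_tendsto_of_complete (cauchySeq_of_le_geometric (1 / 2) _
      (by norm_num) (hk₀ t (abs_le.1 (by linarith))))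
    exact ⟨z, (tendsto_add_atTop_iff_nat k₀).1 hz⟩
  choose g hg using hlim
  refine ⟨g, tendstoLocallyUniformly_iff_forall_isCompact.2 fun K hK => ?_⟩
  obtain ⟨T, hT, hKT⟩ := hK.isBounded.subset_closedBall_lt 0 0
  rw [Real.closedBall_eq_Icc, zero_sub, zero_add] at hKT
  obtain ⟨k₀, hk₀⟩ := hshift T hT
  rw [Metric.tendstoUniformlyOn_iff]
  intro ε hε
  have h0 : Tendsto (fun m : ℕ => (1 / 2 : ℝ) ^ k₀ * (1 / 2) ^ m / (1 - 1 / 2)) atTop (𝓝 0) := by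
    simpa using ((tendsto_pow_atTop_nhds_zero_of_lt_one (r := (1 / 2 : ℝ)) (by norm_num)
      (by norm_num)).const_mul ((1 / 2 : ℝ) ^ k₀)).div_const (1 - 1 / 2)
  obtain ⟨m₀, hm₀⟩ := eventually_atTop.1 (h0.eventually_lt_const hε)
  filter_upwards [eventually_ge_atTop (m₀ + k₀)] with k hk t ht
  obtain ⟨m, rfl⟩ := Nat.exists_eq_add_of_le' (show k₀ ≤ k by omega)
  rw [dist_comm]
  exact (dist_le_of_le_geometric_of_tendsto (1 / 2) _ (by norm_num) (hk₀ t (hKT ht))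
    ((tendsto_add_atTop_iff_nat k₀).2 (hg t)) m).trans_lt (hm₀ m (by omega))

theorem solvesAt_of_tendstoLocallyUniformly {α : ℕ → ℤ → ℝ → ℂ} {γ : ℤ → ℝ → ℂ}
    (hα : ∀ k n, Continuous (α k n)) {n : ℤ} (hsol : ∀ᶠ k in atTop, SolvesAt (α k) n)
    (hγ : ∀ n, TendstoLocallyUniformly (fun k => α k n) (γ n) atTop) : SolvesAt γ n := by
  have hγc : ∀ n, Continuous (γ n) := fun n => (hγ n).continuous
    (Eventually.of_forall fun k => hα k n).frequently
  let F : ℕ → ℤ → C(ℝ, ℂ) := fun k n => ⟨α k n, hα k n⟩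
  let G : ℤ → C(ℝ, ℂ) := fun n => ⟨γ n, hγc n⟩
  have hFG : ∀ n, Tendsto (fun k => F k n) atTop (𝓝 (G n)) := fun n =>
    ContinuousMap.tendsto_iff_tendstoLocallyUniformly.2 (hγ n)
  let conj : C(ℂ, ℂ) := ⟨starRingEnd ℂ, Complex.continuous_conj⟩
  have hconj : Tendsto (fun k => conj.comp (F k n)) atTop (𝓝 (conj.comp (G n))) :=
    ((ContinuousMap.continuous_postcomp conj).tendsto _).comp (hFG n)
  let R : (ℤ → C(ℝ, ℂ)) → C(ℝ, ℂ) := fun H => ContinuousMap.const ℝ Complex.I *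
    (1 + H n * conj.comp (H n)) * (H (n + 1) + H (n - 1)) -
      ContinuousMap.const ℝ (2 * Complex.I) * H n
  have hR : Tendsto (fun k => R (F k)) atTop (𝓝 (R G)) :=
    ((tendsto_const_nhds.mul (tendsto_const_nhds.add ((hFG n).mul hconj))).mul
      ((hFG _).add (hFG _))).sub (tendsto_const_nhds.mul (hFG n))
  have hR' := (ContinuousMap.tendsto_iff_tendstoLocallyUniformly.1 hR)
  have hval : ∀ (H : ℤ → C(ℝ, ℂ)) (t : ℝ), R H t = Complex.I *
      (1 + (Complex.normSq (H n t) : ℂ)) * (H (n + 1) t + H (n - 1) t) -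
      2 * Complex.I * H n t := by
    intro H t
    rw [← Complex.mul_conj]
    rfl
  intro t
  refine (hasDerivAt_of_tendstoLocallyUniformlyOn isOpen_univ
    (tendstoLocallyUniformlyOn_univ.2 hR') ?_
    (fun t _ => (tendstoLocallyUniformlyOn_univ.2 (hγ n)).tendsto_at (mem_univ t))
    (mem_univ t)).congr_deriv (hval G t)
  filter_upwards [hsol] with k hk t _
  exact (hk t).congr_deriv (hval (F k) t).symm

theorem wMoment_le_liminf {p q T : ℝ} (hp : 0 ≤ p) {α : ℕ → ℤ → ℝ → ℂ} {γ : ℤ → ℝ → ℂ}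
    (hα : ∀ k n, Continuous (α k n))
    (hγ : ∀ n t, Tendsto (fun k => α k n t) atTop (𝓝 (γ n t))) :
    wMoment p q T γ ≤ liminf (fun k => wMoment p q T (α k)) atTop := by
  have hcont : Continuous fun z : ℂ => ‖z‖ ^ (2 * p) :=
    continuous_norm.rpow_const fun _ => Or.inr (by positivity)
  unfold wMoment
  refine le_trans (lintegral_mono fun t => ?_) (lintegral_liminf_le fun k => ?_)
  · simp only [← lintegral_count]
    refine le_trans (lintegral_mono fun n => ?_) (lintegral_liminf_le fun k => by fun_prop)
    refine le_of_eq (Tendsto.liminf_eq ?_).symm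
    exact ENNReal.tendsto_ofReal (((hcont.tendsto _).comp (hγ n t)).const_mul _)
  · refine Measurable.tsum fun n => ?_
    exact ((hcont.comp (hα k n)).measurable.const_mul _).ennreal_ofReal

theorem summable_jap_rpow {q : ℝ} (hq : 1 < q) : Summable fun n : ℤ => jap n ^ (-q) := by
  refine Summable.of_norm_bounded_eventually (Real.summable_abs_int_rpow hq) ?_
  filter_upwards [(Set.finite_singleton (0 : ℤ)).compl_mem_cofinite] with n hn
  have hn' : 0 < |(n : ℝ)| := abs_pos.2 (Int.cast_ne_zero.2 (by simpa using hn))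
  rw [Real.norm_of_nonneg (Real.rpow_nonneg (jap_pos n).le _)]
  exact Real.rpow_le_rpow_of_nonpos hn' (abs_le_jap n) (by linarith)

theorem summable_exp_neg_jap : Summable fun n : ℤ => Real.exp (-jap n) := by
  refine Summable.of_nonneg_of_le (fun n => (Real.exp_pos _).le) (fun n => ?_)
    ((summable_jap_rpow (q := 2) (by norm_num)).mul_left 2)
  have h := Real.quadratic_le_exp_of_nonneg (jap_pos n).le
  have hj := jap_pos n
  rw [Real.exp_neg, Real.rpow_neg hj.le, Real.rpow_two, ← div_eq_mul_inv,
    inv_le_comm₀ (Real.exp_pos _) (by positivity), inv_div]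
  linarith

theorem exists_mul_rpow_le_add {C θ : ℝ} (hC : 0 ≤ C) (hθ : 0 ≤ θ) (hθ1 : θ < 1) :
    ∃ K, ∀ l, 0 ≤ l → C * l ^ θ ≤ l + K := by
  set l₀ := C ^ (1 - θ)⁻¹ with hl₀
  refine ⟨C * l₀ ^ θ, fun l hl => ?_⟩
  have hl₀' : 0 ≤ l₀ := by positivity
  rcases le_total l l₀ with h | h
  · have : C * l ^ θ ≤ C * l₀ ^ θ := by gcongr
    linarith
  · have h1 : C ≤ l ^ (1 - θ) := by
      calc C = l₀ ^ (1 - θ) := by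
            rw [hl₀, ← Real.rpow_mul hC, inv_mul_cancel₀ (by linarith), Real.rpow_one]
        _ ≤ _ := by gcongr
    have h2 : C * l ^ θ ≤ l ^ (1 - θ) * l ^ θ := by gcongr
    rw [← Real.rpow_add' hl (by simp), sub_add_cancel, Real.rpow_one] at h2
    have : 0 ≤ C * l₀ ^ θ := by positivity
    linarith

theorem exists_sq_norm_le_exp {p q A T : ℝ} {α : ℤ → ℝ → ℂ} (hq : 1 < q) (hp : q < p)
    (hα : ∀ n, SolvesAt α n) (hA : 0 ≤ A) (h0 : ∀ n, ‖α n 0‖ ^ 2 ≤ A * Real.exp (1 * jap n))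
    (hT : 0 ≤ T) (hm : wMoment p q T α < ⊤) :
    ∃ K, ∀ n, ∀ t ∈ Icc (-T) T, ‖α n t‖ ^ 2 ≤ K * Real.exp (8 * jap n) := by
  set D := (wMoment p q T α).toReal with hD
  have hD0 : 0 ≤ D := ENNReal.toReal_nonneg
  obtain ⟨K, hK⟩ := exists_mul_rpow_le_add (C := 4 * (T + D)) (θ := q / p) (by positivity)
    (div_nonneg (by linarith) (by linarith)) ((div_lt_one (by linarith)).2 hp)
  refine ⟨(1 + A) * Real.exp K, fun n t ht => ?_⟩
  have hc : IsControlled p q q A 1 T D n.natAbs α := .of_solvesAt hα hA zero_le_one h0 (by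
    rw [sub_self, Real.rpow_zero, mul_one, hD, ENNReal.ofReal_toReal hm.ne])
  have h1 := hc.one_add_sq_le (n := n) (by linarith) (by linarith) hD0 (by omega) ht
  set l : ℝ := 2 * n.natAbs + 2 with hl
  have hl4 : l ≤ 4 * jap n := by
    have : (n.natAbs : ℝ) = |(n : ℝ)| := by rw [Nat.cast_natAbs, Int.cast_abs]
    linarith [one_le_jap n, abs_le_jap n]
  have hl0 : 0 ≤ l := by positivity
  have h2 : 1 + A * Real.exp (1 * l) ≤ (1 + A) * Real.exp l := by
    have := Real.one_le_exp hl0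
    rw [one_mul]
    nlinarith
  calc ‖α n t‖ ^ 2 ≤ 1 + ‖α n t‖ ^ 2 := by linarith
    _ ≤ _ := h1
    _ ≤ ((1 + A) * Real.exp l) * Real.exp (l + K) := by
      gcongr
      linarith [hK l hl0]
    _ = (1 + A) * Real.exp K * Real.exp (2 * l) := by
      rw [Real.exp_add l K, two_mul l, Real.exp_add l l]; ring
    _ ≤ _ := by gcongr ?_ * Real.exp ?_; linarith

theorem isGoodALSolution_of_wMoment_lt_top {p q A : ℝ} {α : ℤ → ℝ → ℂ} (hq : 1 < q) (hp : q < p)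
    (hα : ∀ n, SolvesAt α n) (hA : 0 ≤ A) (h0 : ∀ n, ‖α n 0‖ ^ 2 ≤ A * Real.exp (1 * jap n))
    (hm : ∀ T > 0, wMoment p q T α < ⊤) : IsGoodALSolution α := by
  refine ⟨alSolution_iff.2 hα, ⟨p, q, hq, hp, hm⟩, 9, by norm_num, fun T hT => ?_⟩
  obtain ⟨K, hK⟩ := exists_sq_norm_le_exp hq hp hα hA h0 hT.le (hm T hT)
  refine (iSup₂_le fun t ht => ENNReal.tsum_le_tsum fun n => ENNReal.ofReal_le_ofReal ?_).trans_lt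
    (summable_exp_neg_jap.mul_left K).tsum_ofReal_lt_top
  calc Real.exp (-(9 * jap n)) * ‖α n t‖ ^ 2
      ≤ Real.exp (-(9 * jap n)) * (K * Real.exp (8 * jap n)) := by gcongr; exact hK n t ht
    _ = K * Real.exp (-jap n) := by
      rw [mul_left_comm, ← Real.exp_add]; ring_nf

theorem exists_isGoodALSolution_of_approx {p q r A : ℝ} {a : ℤ → ℂ} {α : ℕ → ℤ → ℝ → ℂ}
    (hq : 1 < q) (hqr : q ≤ r) (hr : r < p) (hA : 0 ≤ A)
    (ha : ∀ n, ‖a n‖ ^ 2 ≤ A * Real.exp (1 * jap n)) (hα : ∀ k n, Continuous (α k n))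
    (hsol : ∀ᶠ k in atTop, ∀ n : ℤ, n.natAbs ≤ 2 * 2 ^ k → SolvesAt (α k) n ∧ α k n 0 = a n)
    (hm : ∀ T > 0, ∃ D, 0 ≤ D ∧ ∀ᶠ k : ℕ in atTop,
      wMoment p q T (α k) ≤ ENNReal.ofReal (D * (2 * 2 ^ k + 2 : ℝ) ^ (r - q)))
    (hlim : ∀ T > 0, liminf (fun k => wMoment p q T (α k)) atTop < ⊤) :
    ∃ γ, IsGoodALSolution γ ∧ ∀ n, γ n 0 = a n := by
  have hpow : Tendsto (fun k : ℕ => 2 ^ k) atTop atTop :=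
    tendsto_pow_atTop_atTop_of_one_lt one_lt_two
  have hle : ∀ n : ℤ, ∀ᶠ k : ℕ in atTop, n.natAbs ≤ 2 ^ k := fun n =>
    hpow.eventually_ge_atTop _
  have hclose : ∀ T > 0, ∀ᶠ k in atTop, ∀ n : ℤ, n.natAbs ≤ 2 ^ k → ∀ t ∈ Icc (-T) T,
      ‖α k n t - α (k + 1) n t‖ ≤ (1 / 2) ^ k := by
    intro T hT
    obtain ⟨D, hD, hmD⟩ := hm T hT
    have h2 : (1 : ℝ) ≤ 2 ^ (r - q) := Real.one_le_rpow (by norm_num) (by linarith)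
    have hstab := hpow.eventually (eventually_norm_sub_le (p₁ := p) (q₁ := q) (r₁ := r) (p₂ := p)
      (q₂ := q) (r₂ := r) (A := A) (c := 1) (T := T) (D := D * 2 ^ (r - q)) (by linarith)
      (by linarith) (by linarith) hr (by linarith) (by linarith) hr hA zero_le_one hT.le
      (by positivity))
    have hmD' := (tendsto_add_atTop_nat 1).eventually hmD
    have hsol' := (tendsto_add_atTop_nat 1).eventually hsol
    filter_upwards [hstab, hsol, hsol', hmD, hmD'] with k hs hk hk1 hmk hmk1 n hn t ht
    have hinit : ∀ n : ℤ, n.natAbs ≤ 2 * 2 ^ k →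
        ‖a n‖ ^ 2 ≤ A * Real.exp (1 * (2 * ((2 ^ k : ℕ) : ℝ) + 2)) := fun n hn => by
      refine (ha n).trans ?_
      have := jap_le_of_natAbs_le hn
      push_cast at this ⊢
      gcongr
      linarith
    have hn1 : ∀ n : ℤ, n.natAbs ≤ 2 * 2 ^ k → n.natAbs ≤ 2 * 2 ^ (k + 1) := fun n hn => by
      rw [pow_succ]; omega
    refine (hs (α k) (α (k + 1)) ⟨hα k, fun n hn => (hk n hn).1, fun n hn => ?_, ?_⟩
      ⟨hα _, fun n hn => (hk1 n (hn1 n hn)).1, fun n hn => ?_, ?_⟩ (fun n hn => ?_)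
      n hn t ht).trans ?_
    · rw [(hk n hn).2]; exact hinit n hn
    · refine hmk.trans (ENNReal.ofReal_le_ofReal ?_)
      push_cast
      rw [mul_assoc]
      gcongr
      exact le_mul_of_one_le_left (by positivity) h2
    · rw [(hk1 n (hn1 n hn)).2]; exact hinit n hn
    · refine hmk1.trans (ENNReal.ofReal_le_ofReal ?_)
      push_cast
      rw [mul_assoc, ← Real.mul_rpow (by norm_num) (by positivity)]
      gcongr
      rw [pow_succ]; linarith
    · rw [(hk n hn).2, (hk1 n (hn1 n hn)).2]
    · exact pow_le_pow_of_le_one (by norm_num) (by norm_num) Nat.lt_two_pow_self.le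
  have hγ : ∀ n, ∃ g : ℝ → ℂ, TendstoLocallyUniformly (fun k => α k n) g atTop := fun n =>
    exists_tendstoLocallyUniformly fun T hT => by
      filter_upwards [hclose T hT, hle n] with k hk hnk t ht using hk n hnk t ht
  choose γ hγ using hγ
  have hpt : ∀ n t, Tendsto (fun k => α k n t) atTop (𝓝 (γ n t)) := fun n t =>
    (tendstoLocallyUniformlyOn_univ.2 (hγ n)).tendsto_at (mem_univ t)
  have hγ0 : ∀ n, γ n 0 = a n := fun n => by
    refine tendsto_nhds_unique (hpt n 0) (tendsto_const_nhds.congr' ?_)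
    filter_upwards [hsol, hle n] with k hk hnk
    exact (hk n (by omega)).2.symm
  have hγsol : ∀ n, SolvesAt γ n := fun n => by
    refine solvesAt_of_tendstoLocallyUniformly hα ?_ hγ
    filter_upwards [hsol, hle n] with k hk hnk
    exact (hk n (by omega)).1
  refine ⟨γ, isGoodALSolution_of_wMoment_lt_top hq (hqr.trans_lt hr) hγsol hA
    (fun n => by rw [hγ0]; exact ha n) (fun T hT => ?_), hγ0⟩
  exact (wMoment_le_liminf (by linarith) hα hpt).trans_lt (hlim T hT)

/-- Adjacency matrix of the nearest-neighbour graph on a finite set of sites. -/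
def latticeAdj (S : Finset ℤ) (n m : S) : ℝ := if ((n : ℤ) - m).natAbs = 1 then 1 else 0

/-- Extension by zero of a configuration on finitely many sites. -/
def zeroExtend (S : Finset ℤ) (x : S → ℂ) (n : ℤ) : ℂ := if h : n ∈ S then x ⟨n, h⟩ else 0

theorem zeroExtend_coe {S : Finset ℤ} (x : S → ℂ) (n : S) : zeroExtend S x n = x n := by
  simp [zeroExtend]

theorem zeroExtend_of_mem {S : Finset ℤ} (x : S → ℂ) {n : ℤ} (hn : n ∈ S) :
    zeroExtend S x n = x ⟨n, hn⟩ := by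
  simp [zeroExtend, hn]

theorem zeroExtend_of_notMem {S : Finset ℤ} (x : S → ℂ) {n : ℤ} (hn : n ∉ S) :
    zeroExtend S x n = 0 := by
  simp [zeroExtend, hn]

theorem continuous_zeroExtend (S : Finset ℤ) (n : ℤ) :
    Continuous fun x : S → ℂ => zeroExtend S x n := by
  unfold zeroExtend
  split_ifs
  · exact continuous_apply _
  · exact continuous_const

theorem sum_latticeAdj_mul (S : Finset ℤ) (x : S → ℂ) (n : S) :
    ∑ m, (latticeAdj S n m : ℂ) * x m = zeroExtend S x (n + 1) + zeroExtend S x (n - 1) := by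
  have h1 : ∀ k : ℤ, zeroExtend S x k = ∑ m ∈ S, if m = k then zeroExtend S x m else 0 := by
    intro k
    rw [Finset.sum_ite_eq' S k]
    split_ifs with h
    · rfl
    · exact zeroExtend_of_notMem x h
  rw [h1 (n + 1), h1 (n - 1), ← Finset.sum_add_distrib, ← Finset.sum_coe_sort S]
  refine Finset.sum_congr rfl fun m _ => ?_
  rw [zeroExtend_coe, latticeAdj]
  have h : ((n : ℤ) - m).natAbs = 1 ↔ (m : ℤ) = n + 1 ∨ (m : ℤ) = n - 1 := by omega
  by_cases h1 : (m : ℤ) = n + 1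
  · rw [if_pos (h.2 (.inl h1)), if_pos h1, if_neg (by omega)]
    simp
  · by_cases h2 : (m : ℤ) = n - 1
    · rw [if_pos (h.2 (.inr h2)), if_neg h1, if_pos h2]
      simp
    · rw [if_neg (by tauto), if_neg h1, if_neg h2]
      simp

theorem solvesAt_zeroExtend {S : Finset ℤ} {x : ℝ → S → ℂ} {n : S}
    (h : ∀ t, HasDerivAt (fun s => x s n) (alField (latticeAdj S) (x t) n) t) :
    SolvesAt (fun n t => zeroExtend S (x t) n) n := by
  intro t
  simp only [zeroExtend_coe]
  refine (h t).congr_deriv ?_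
  rw [alField, sum_latticeAdj_mul]

theorem exists_measure_lt_le {Ω : Type*} [MeasurableSpace Ω] {μ : Measure Ω} [IsFiniteMeasure μ]
    {g : Ω → ℝ} (hg : Measurable g) {δ : ℝ≥0∞} (hδ : 0 < δ) : ∃ R : ℝ, μ {ω | R < g ω} ≤ δ := by
  have h := tendsto_measure_iInter_atTop (μ := μ) (s := fun N : ℕ => {ω | (N : ℝ) < g ω})
    (fun N => (measurableSet_lt measurable_const hg).nullMeasurableSet)
    (fun N N' hN ω hω => show (N : ℝ) < g ω from lt_of_le_of_lt (Nat.cast_le.2 hN) hω)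
    ⟨0, measure_ne_top _ _⟩
  have h0 : (⋂ N : ℕ, {ω | (N : ℝ) < g ω}) = ∅ := by
    refine eq_empty_of_forall_notMem fun ω hω => ?_
    obtain ⟨N, hN⟩ := exists_nat_ge (g ω)
    exact absurd (mem_iInter.1 hω N) (not_lt.2 hN)
  rw [h0, measure_empty] at h
  obtain ⟨N, hN⟩ := (h.eventually_le_const hδ).exists
  exact ⟨N, hN⟩

theorem IsWhiteNoise.exists_truncated {β : ℝ} (hβ : 0 < β) {μ : Measure (ℤ → ℂ)}
    (hμ : IsWhiteNoise β μ) (M : ℕ) {δ : ℝ≥0∞} (hδ : 0 < δ) :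
    ∃ X : (ℤ → ℂ) → ℤ → ℝ → ℂ, (∀ a n, Continuous (X a n)) ∧
      (∀ n, Measurable fun z : (ℤ → ℂ) × ℝ => X z.1 n z.2) ∧
      μ {a | ¬ ∀ n : ℤ, n.natAbs ≤ M → SolvesAt (X a) n ∧ X a n 0 = a n} ≤ δ ∧
      ∀ f : ℂ → ℝ≥0∞, Measurable f → f 0 = 0 →
        ∀ n t, ∫⁻ a, f (X a n t) ∂μ ≤ ∫⁻ z, f z ∂muBeta β := by
  have := hμ.1
  have := hμ.isProbabilityMeasure_muBeta
  set S : Finset ℤ := Finset.Icc (-M) M with hS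
  let res : (ℤ → ℂ) → S → ℂ := fun a n => a n
  have hres : Continuous res := by fun_prop
  have hlog : Continuous (logMass (ι := S)) := contDiff_logMass.continuous
  obtain ⟨R, hR⟩ := exists_measure_lt_le (μ := μ) (hlog.comp hres).measurable hδ
  obtain ⟨Φ, hΦ0, hΦd, hΦm, hΦv, hΦc⟩ := exists_cutFlow (A := latticeAdj S)
    (fun n m => by rw [latticeAdj, latticeAdj, ← Int.natAbs_neg, neg_sub])
    (fun n => by simp [latticeAdj]) R
  have hcont : ∀ n, Continuous fun z : (ℤ → ℂ) × ℝ => zeroExtend S (Φ z.2 (res z.1)) n :=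
    fun n => (continuous_zeroExtend S n).comp
      (hΦc.comp (continuous_snd.prodMk (hres.comp continuous_fst)))
  refine ⟨fun a n t => zeroExtend S (Φ t (res a)) n,
    fun a n => (hcont n).comp (Continuous.prodMk_right a), fun n => (hcont n).measurable,
    (measure_mono ?_).trans hR, fun f hf hf0 n t => ?_⟩
  · intro a ha
    by_contra hle
    refine ha fun n hn => ?_
    have hnS : n ∈ S := Finset.mem_Icc.2 (by omega)
    refine ⟨solvesAt_zeroExtend (n := ⟨n, hnS⟩) fun t => hΦd t _ (not_lt.1 hle) _, ?_⟩
    simp only [hΦ0, zeroExtend_of_mem _ hnS, res]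
  · by_cases hn : n ∈ S
    · have hΦt : Measurable (Φ t) := (hΦc.comp (Continuous.prodMk_right t)).measurable
      have hg : Measurable fun x : S → ℂ => f (x ⟨n, hn⟩) := by fun_prop
      simp only [zeroExtend_of_mem _ hn]
      calc ∫⁻ a, f (Φ t (res a) ⟨n, hn⟩) ∂μ
          = ∫⁻ x, f (Φ t x ⟨n, hn⟩) ∂μ.map res :=
            (lintegral_map (hg.comp hΦt) hres.measurable).symm
        _ = ∫⁻ x, f (x ⟨n, hn⟩) ∂(μ.map res).map (Φ t) := (lintegral_map hg hΦt).symm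
        _ ≤ ∫⁻ x, f (x ⟨n, hn⟩) ∂Measure.pi fun _ : S => muBeta β := by
            rw [show μ.map res = _ from hμ.map_restrict S]
            exact lintegral_mono' (map_pi_muBeta_le hβ hΦt (hΦm t) (hΦv t)) le_rfl
        _ = ∫⁻ z, f z ∂muBeta β :=
            (measurePreserving_eval (fun _ : S => muBeta β) ⟨n, hn⟩).lintegral_comp hf
    · simp [zeroExtend_of_notMem _ hn, hf0]

section RandomField

variable {Ω : Type*} [MeasurableSpace Ω] {μ : Measure Ω} {X : Ω → ℤ → ℝ → ℂ}

theorem measurable_wMoment_integrand (hX : ∀ n, Measurable fun z : Ω × ℝ => X z.1 n z.2) (p q : ℝ) :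
    Measurable fun z : Ω × ℝ =>
      ∑' n : ℤ, ENNReal.ofReal (jap n ^ (-q) * ‖X z.1 n z.2‖ ^ (2 * p)) :=
  Measurable.tsum fun n => (((hX n).norm.pow_const _).const_mul _).ennreal_ofReal

theorem measurable_wMoment (hX : ∀ n, Measurable fun z : Ω × ℝ => X z.1 n z.2) (p q T : ℝ) :
    Measurable fun a => wMoment p q T (X a) :=
  (measurable_wMoment_integrand hX p q).lintegral_prod_right'

theorem lintegral_wMoment_le [SFinite μ] (hX : ∀ n, Measurable fun z : Ω × ℝ => X z.1 n z.2)
    {p q T : ℝ} {m : ℝ≥0∞} (hm : ∀ n t, ∫⁻ a, ENNReal.ofReal (‖X a n t‖ ^ (2 * p)) ∂μ ≤ m) :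
    ∫⁻ a, wMoment p q T (X a) ∂μ ≤
      (∑' n : ℤ, ENNReal.ofReal (jap n ^ (-q)) * m) * volume (Icc (-T) T) := by
  unfold wMoment
  rw [lintegral_lintegral_swap (measurable_wMoment_integrand hX p q).aemeasurable,
    ← setLIntegral_const]
  refine lintegral_mono fun t => ?_
  have hXt : ∀ n, Measurable fun a => X a n t := fun n => (hX n).comp measurable_prodMk_right
  rw [lintegral_tsum fun n =>
    (((hXt n).norm.pow_const _).const_mul _).ennreal_ofReal.aemeasurable]
  refine ENNReal.tsum_le_tsum fun n => ?_
  simp_rw [ENNReal.ofReal_mul (Real.rpow_nonneg (jap_pos n).le (-q))]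
  rw [lintegral_const_mul _ ((hXt n).norm.pow_const _).ennreal_ofReal]
  gcongr
  exact hm n t

end RandomField

theorem ae_exists_sq_norm_le_exp_jap {β : ℝ} (hβ : 0 < β) {μ : Measure (ℤ → ℂ)}
    (hμ : IsWhiteNoise β μ) :
    ∀ᵐ a ∂μ, ∃ A, 0 ≤ A ∧ ∀ n, ‖a n‖ ^ 2 ≤ A * Real.exp (1 * jap n) := by
  have hmap : ∀ n : ℤ, μ.map (fun a => a n) = muBeta β := fun n => by
    ext s hs
    rw [Measure.map_apply (measurable_pi_apply n) hs]
    simpa [preimage] using hμ.2 {n} (fun _ => s) fun _ => hs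
  have hm := moment_muBeta_lt_top (p := 1) hβ zero_le_one (by linarith)
  set m := ∫⁻ z, ENNReal.ofReal (‖z‖ ^ (2 * (1 : ℝ))) ∂muBeta β with hmdef
  have hmeas : ∀ n : ℤ, Measurable fun a : ℤ → ℂ =>
      ENNReal.ofReal (Real.exp (-(1 * jap n)) * ‖a n‖ ^ 2) := fun n =>
    (((measurable_pi_apply n).norm.pow_const 2).const_mul _).ennreal_ofReal
  have hint : ∫⁻ a, ∑' n : ℤ, ENNReal.ofReal (Real.exp (-(1 * jap n)) * ‖a n‖ ^ 2) ∂μ < ⊤ := by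
    rw [lintegral_tsum fun n => (hmeas n).aemeasurable]
    have : ∀ n : ℤ, ∫⁻ a : ℤ → ℂ, ENNReal.ofReal (Real.exp (-(1 * jap n)) * ‖a n‖ ^ 2) ∂μ =
        ENNReal.ofReal (Real.exp (-jap n)) * m := fun n => by
      simp_rw [ENNReal.ofReal_mul (Real.exp_pos (-(1 * jap n))).le, one_mul]
      rw [lintegral_const_mul _ (by fun_prop), hmdef, ← hmap n,
        lintegral_map (by fun_prop) (measurable_pi_apply n)]
      simp
    simp_rw [this]
    rw [ENNReal.tsum_mul_right]
    exact ENNReal.mul_lt_top summable_exp_neg_jap.tsum_ofReal_lt_top hm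
  filter_upwards [ae_lt_top (Measurable.tsum hmeas) hint.ne] with a ha
  exact exists_initial_bound (α := fun n _ => a n) ((iSup₂_le fun _ _ => le_rfl).trans_lt ha)

theorem summable_dyadic_rpow {ε : ℝ} (hε : 0 < ε) :
    Summable fun k : ℕ => (2 * 2 ^ k + 2 : ℝ) ^ (-ε) := by
  refine Summable.of_nonneg_of_le (fun k => by positivity) (fun k => ?_)
    (summable_geometric_of_lt_one (r := (2 : ℝ) ^ (-ε)) (by positivity)
      (Real.rpow_lt_one_of_one_lt_of_neg (by norm_num) (by linarith)))
  rw [← Real.rpow_mul_natCast (by norm_num), mul_comm (-ε), Real.rpow_natCast_mul (by norm_num)]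
  refine Real.rpow_le_rpow_of_nonpos (by positivity) ?_ (by linarith)
  have : (0 : ℝ) < 2 ^ k := by positivity
  linarith

/-- Uniform bounds in expectation give almost sure bounds up to arbitrarily small powers of the
dyadic scale. -/
theorem ae_le_dyadic_rpow_and_liminf_lt_top {Ω : Type*} [MeasurableSpace Ω] {μ : Measure Ω}
    {Y : ℕ → Ω → ℝ≥0∞} (hY : ∀ k, Measurable (Y k)) {C : ℝ≥0∞} (hC : C < ⊤)
    (h : ∀ k, ∫⁻ ω, Y k ω ∂μ ≤ C) {ε : ℝ} (hε : 0 < ε) :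
    ∀ᵐ ω ∂μ, (∃ D, 0 ≤ D ∧ ∀ k, Y k ω ≤ ENNReal.ofReal (D * (2 * 2 ^ k + 2 : ℝ) ^ ε)) ∧
      liminf (fun k => Y k ω) atTop < ⊤ := by
  have hlim : ∫⁻ ω, liminf (fun k => Y k ω) atTop ∂μ < ⊤ :=
    (lintegral_liminf_le hY).trans_lt (lt_of_le_of_lt
      (liminf_le_of_le (by isBoundedDefault) fun b hb => by
        obtain ⟨k, hk⟩ := hb.exists
        exact hk.trans (h k)) hC)
  have hsum : ∫⁻ ω, ∑' k : ℕ, ENNReal.ofReal ((2 * 2 ^ k + 2 : ℝ) ^ (-ε)) * Y k ω ∂μ < ⊤ := by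
    rw [lintegral_tsum fun k => ((hY k).const_mul _).aemeasurable]
    simp_rw [lintegral_const_mul _ (hY _)]
    refine (ENNReal.tsum_le_tsum fun k => mul_le_mul_right (h k) _).trans_lt ?_
    rw [ENNReal.tsum_mul_right]
    exact ENNReal.mul_lt_top (summable_dyadic_rpow hε).tsum_ofReal_lt_top hC
  filter_upwards [ae_lt_top (Measurable.liminf hY) hlim.ne,
    ae_lt_top (Measurable.tsum fun k => (hY k).const_mul _) hsum.ne] with ω h1 h2
  refine ⟨⟨(∑' k : ℕ, ENNReal.ofReal ((2 * 2 ^ k + 2 : ℝ) ^ (-ε)) * Y k ω).toReal,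
    ENNReal.toReal_nonneg, fun k => ?_⟩, h1⟩
  have h3 := ENNReal.le_tsum (f := fun k : ℕ =>
    ENNReal.ofReal ((2 * 2 ^ k + 2 : ℝ) ^ (-ε)) * Y k ω) k
  have hpos : (0 : ℝ) < (2 * 2 ^ k + 2 : ℝ) ^ ε := by positivity
  rw [Real.rpow_neg (by positivity), ENNReal.ofReal_inv_of_pos hpos] at h3
  rw [ENNReal.ofReal_mul ENNReal.toReal_nonneg, ENNReal.ofReal_toReal h2.ne, mul_comm]
  exact (ENNReal.inv_mul_le_iff (by simpa using hpos) ENNReal.ofReal_ne_top).1 h3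

theorem wMoment_mono {p q T T' : ℝ} (h : T ≤ T') (α : ℤ → ℝ → ℂ) :
    wMoment p q T α ≤ wMoment p q T' α :=
  lintegral_mono_set (Icc_subset_Icc (by linarith) h)

theorem ae_exists_isGoodALSolution {β : ℝ} (hβ : 0 < β) {μ : Measure (ℤ → ℂ)}
    (hμ : IsWhiteNoise β μ) : ∀ᵐ a ∂μ, ∃ α, IsGoodALSolution α ∧ ∀ n, α n 0 = a n := by
  have := hμ.1
  set p := 1 + β with hp
  set q := 1 + β / 2 with hq
  set r := q + β / 4 with hr
  have hm := moment_muBeta_lt_top (p := p) hβ (by positivity) le_rfl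
  set m := ∫⁻ z, ENNReal.ofReal (‖z‖ ^ (2 * p)) ∂muBeta β
  have hX := fun k : ℕ => hμ.exists_truncated hβ (2 * 2 ^ k) (δ := ENNReal.ofReal ((1 / 2) ^ k))
    (by simp)
  choose X hXc hXm hXsol hXint using hX
  have hmom : ∀ k n t, ∫⁻ a, ENNReal.ofReal (‖X k a n t‖ ^ (2 * p)) ∂μ ≤ m := fun k n t =>
    hXint k (fun z => ENNReal.ofReal (‖z‖ ^ (2 * p))) (by fun_prop)
      (by rw [norm_zero, Real.zero_rpow (by positivity), ENNReal.ofReal_zero]) n t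
  have hsum : ∑' n : ℤ, ENNReal.ofReal (jap n ^ (-q)) * m < ⊤ := by
    rw [ENNReal.tsum_mul_right]
    exact ENNReal.mul_lt_top (summable_jap_rpow (by linarith)).tsum_ofReal_lt_top hm
  have hbc := ae_eventually_notMem (ne_top_of_le_ne_top summable_geometric_two.tsum_ofReal_ne_top
    (ENNReal.tsum_le_tsum hXsol))
  have hbound : ∀ᵐ a ∂μ, ∀ N : ℕ, _ := ae_all_iff.2 fun N : ℕ =>
    ae_le_dyadic_rpow_and_liminf_lt_top (fun k => measurable_wMoment (hXm k) p q N)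
      (ENNReal.mul_lt_top hsum (measure_Icc_lt_top (μ := volume) (a := -(N : ℝ)) (b := N)))
      (fun k => lintegral_wMoment_le (hXm k) (hmom k)) (show 0 < r - q by linarith)
  filter_upwards [ae_exists_sq_norm_le_exp_jap hβ hμ, hbc, hbound] with a ⟨A, hA, ha⟩ hsol hb
  refine exists_isGoodALSolution_of_approx (α := fun k => X k a) (by linarith : 1 < q)
    (by linarith : q ≤ r) (by linarith : r < p) hA ha (fun k n => hXc k a n) ?_ (fun T hT => ?_)
    fun T hT => ?_
  · filter_upwards [hsol] with k hk
    exact not_not.1 hk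
  · obtain ⟨N, hN⟩ := exists_nat_ge T
    obtain ⟨D, hD, hDk⟩ := (hb N).1
    exact ⟨D, hD, .of_forall fun k => (wMoment_mono hN _).trans (hDk k)⟩
  · obtain ⟨N, hN⟩ := exists_nat_ge T
    exact (liminf_le_liminf (.of_forall fun k => wMoment_mono hN _)).trans_lt (hb N).2

/-- fix β > 0. For μ_wn^β-almost every a ∈ ℂ^ℤ there exists a unique global
good solution of the Ablowitz–Ladik system with α_n(0) = a_n for all n. -/
theorem AL_white_noise_wellposedness (β : ℝ) (hβ : 0 < β)
    (μ : Measure (ℤ → ℂ)) (hμ : IsWhiteNoise β μ) :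
    ∀ᵐ a ∂μ, ∃! α : ℤ → ℝ → ℂ,
      IsGoodALSolution α ∧ ∀ n : ℤ, α n 0 = a n := by
  filter_upwards [ae_exists_isGoodALSolution hβ hμ] with a ⟨α, hα, h0⟩
  exact ⟨α, ⟨hα, h0⟩, fun γ hγ => hγ.1.ext hα fun n => (hγ.2 n).trans (h0 n).symm⟩
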